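/- arXiv:1910.08701 — 2 statements merged into one kernel-verified Lean document; each statement's English description precedes it below -/
import Mathlib

section
/- Assume λ_N^W > −1 and let the stepsize satisfy 0 < α < (1+λ_N^W)/L. Set ρ(α) := max{|1−αμ|, |λ_N^W − αL|}. Then ρ(α) ∈ [0,1), and for every k ≥ 0 the D-SG iterates satisfy E[‖x^{(k)} − x^∞‖²] ≤ ρ(α)^{2k} ‖x^{(0)} − x^∞‖² + ((1 − ρ(α)^{2k})/(1 − ρ(α)²)) σ² α² N. -/
open MeasureTheory Filter Real ProbabilityTheory
open scoped RealInnerProductSpace ENNReal NNReal Matrix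

/-- Cocoercivity of a map `k` that provides both affine lower bounds and quadratic upper bounds
for a function. -/
theorem norm_sq_sub_le_inner_of_quadratic_bounds {E : Type*} [NormedAddCommGroup E]
    [InnerProductSpace ℝ E] {h : E → ℝ} {k : E → E} {l : ℝ} (hl : 0 ≤ l)
    (lower : ∀ x y, h x + ⟪k x, y - x⟫ ≤ h y)
    (upper : ∀ x y, h y ≤ h x + ⟪k x, y - x⟫ + l / 2 * ‖y - x‖ ^ 2) (x y : E) :
    ‖k x - k y‖ ^ 2 ≤ l * ⟪k x - k y, x - y⟫ := by
  have half (x y : E) (t : ℝ) :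
      h x - h y + ⟪k x, y - x⟫ + t * ‖k x - k y‖ ^ 2 ≤ l / 2 * t ^ 2 * ‖k x - k y‖ ^ 2 := by
    have h1 := lower x (y + t • (k x - k y))
    have h2 := upper y (y + t • (k x - k y))
    have e1 : ⟪k x, y + t • (k x - k y) - x⟫ = ⟪k x, y - x⟫ + t * ⟪k x, k x - k y⟫ := by
      rw [add_sub_right_comm, inner_add_right, real_inner_smul_right]
    have e2 : ⟪k x, k x - k y⟫ - ⟪k y, k x - k y⟫ = ‖k x - k y‖ ^ 2 := by
      rw [← inner_sub_left, real_inner_self_eq_norm_sq]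
    rw [e1] at h1
    rw [add_sub_cancel_left, real_inner_smul_right, norm_smul, mul_pow, Real.norm_eq_abs,
      sq_abs] at h2
    rw [← e2] at h2 ⊢
    linarith
  have key (t : ℝ) :
      2 * t * ‖k x - k y‖ ^ 2 ≤ ⟪k x - k y, x - y⟫ + l * t ^ 2 * ‖k x - k y‖ ^ 2 := by
    have h1 := half x y t
    have h2 := half y x t
    rw [norm_sub_rev (k y) (k x)] at h2
    have e : ⟪k x, y - x⟫ + ⟪k y, x - y⟫ = -⟪k x - k y, x - y⟫ := by
      rw [← neg_sub x y, inner_neg_right, inner_sub_left]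
      ring
    linarith
  rcases hl.eq_or_lt with rfl | hl
  · by_contra! hcon
    rw [zero_mul] at hcon
    have := key ((⟪k x - k y, x - y⟫ + 1) / (2 * ‖k x - k y‖ ^ 2))
    rw [← mul_div_assoc, div_mul_eq_mul_div, mul_right_comm, mul_div_cancel_left₀ _ (by positivity)]
      at this
    linarith
  · have := key l⁻¹
    field_simp at this
    linarith

section Gradient

variable {E : Type*} [NormedAddCommGroup E] [InnerProductSpace ℝ E] [CompleteSpace E]

theorem HasGradientAt.hasDerivAt_along_line {h : E → ℝ} {g x v : E} {t : ℝ}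
    (hg : HasGradientAt h g (x + t • v)) :
    HasDerivAt (fun s : ℝ => h (x + s • v)) ⟪g, v⟫ t := by
  have hl : HasDerivAt (fun s : ℝ => x + s • v) v t := by
    simpa using ((hasDerivAt_id t).smul_const v).const_add x
  exact (hg.hasFDerivAt.comp_hasDerivAt t hl).congr_deriv (by simp)

theorem ConvexOn.add_inner_gradient_le {h : E → ℝ} {g x : E} (hc : ConvexOn ℝ Set.univ h)
    (hg : HasGradientAt h g x) (y : E) : h x + ⟪g, y - x⟫ ≤ h y := by
  have hline : ConvexOn ℝ Set.univ (fun s : ℝ => h (x + s • (y - x))) := by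
    have := hc.comp_affineMap (AffineMap.lineMap x y : ℝ →ᵃ[ℝ] E)
    simpa [Function.comp_def, AffineMap.lineMap_apply, add_comm] using this
  have hd : HasDerivAt (fun s : ℝ => h (x + s • (y - x))) ⟪g, y - x⟫ 0 :=
    HasGradientAt.hasDerivAt_along_line (by simpa using hg)
  have := hline.le_slope_of_hasDerivAt (Set.mem_univ 0) (Set.mem_univ 1) zero_lt_one hd
  simp [slope_def_field] at this
  linarith

/-- The descent lemma. -/
theorem LipschitzWith.le_add_inner_gradient {h : E → ℝ} {g : E → E} {L : ℝ} (hL : 0 ≤ L)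
    (hg : ∀ x, HasGradientAt h (g x) x) (hlip : LipschitzWith L.toNNReal g) (x y : E) :
    h y ≤ h x + ⟪g x, y - x⟫ + L / 2 * ‖y - x‖ ^ 2 := by
  set v := y - x with hv
  let φ : ℝ → ℝ := fun t => h (x + t • v) - t * ⟪g x, v⟫ - L / 2 * ‖v‖ ^ 2 * t ^ 2
  have hφ (t : ℝ) : HasDerivAt φ (⟪g (x + t • v), v⟫ - ⟪g x, v⟫ - L * t * ‖v‖ ^ 2) t := by
    have h1 := (hg (x + t • v)).hasDerivAt_along_line
    have h2 := (hasDerivAt_id t).mul_const ⟪g x, v⟫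
    have h3 := (hasDerivAt_pow 2 t).const_mul (L / 2 * ‖v‖ ^ 2)
    refine ((h1.sub h2).sub h3).congr_deriv ?_
    push_cast
    ring
  have hanti : AntitoneOn φ (Set.Icc 0 1) := by
    refine antitoneOn_of_deriv_nonpos (convex_Icc 0 1)
      (fun t _ => (hφ t).continuousAt.continuousWithinAt)
      (fun t _ => (hφ t).differentiableAt.differentiableWithinAt) fun t ht => ?_
    rw [interior_Icc] at ht
    rw [(hφ t).deriv, ← inner_sub_left]
    have h1 : ‖g (x + t • v) - g x‖ ≤ L * (t * ‖v‖) := by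
      simpa [norm_smul, abs_of_pos ht.1, hL] using hlip.norm_sub_le (x + t • v) x
    have h2 := real_inner_le_norm (g (x + t • v) - g x) v
    nlinarith [mul_le_mul_of_nonneg_right h1 (norm_nonneg v)]
  have := hanti (Set.left_mem_Icc.2 zero_le_one) (Set.right_mem_Icc.2 zero_le_one) zero_le_one
  simp [φ, hv] at this ⊢
  linarith

/-- For an `m`-strongly convex function with `L`-Lipschitz gradient, the gradient differs from
`(m + L) / 2` times the identity by an `(L - m) / 2`-Lipschitz map. -/
theorem norm_gradient_sub_smul_le {h : E → ℝ} {g : E → E} {m L : ℝ} (hm : 0 < m) (hmL : m ≤ L)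
    (hg : ∀ x, HasGradientAt h (g x) x) (hlip : LipschitzWith L.toNNReal g)
    (hconv : ConvexOn ℝ Set.univ (fun x => h x - m / 2 * ‖x‖ ^ 2)) (x y : E) :
    ‖g x - g y - ((m + L) / 2) • (x - y)‖ ≤ (L - m) / 2 * ‖x - y‖ := by
  have hk (x : E) : HasGradientAt (fun x => h x - m / 2 * ‖x‖ ^ 2) (g x - m • x) x := by
    rw [hasGradientAt_iff_hasFDerivAt]
    refine ((hg x).hasFDerivAt.sub
      ((hasStrictFDerivAt_norm_sq x).hasFDerivAt.const_mul (m / 2))).congr_fderiv ?_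
    ext v
    simp
    ring
  have cocoercive := norm_sq_sub_le_inner_of_quadratic_bounds
    (h := fun x => h x - m / 2 * ‖x‖ ^ 2) (k := fun x => g x - m • x) (sub_nonneg.2 hmL)
    (fun x y => hconv.add_inner_gradient_le (hk x) y) (fun x y => by
      have h1 := hlip.le_add_inner_gradient (hm.le.trans hmL) hg x y
      have h2 : ‖y‖ ^ 2 = ‖x‖ ^ 2 + 2 * ⟪x, y - x⟫ + ‖y - x‖ ^ 2 := by
        rw [← norm_add_sq_real, add_sub_cancel]
      rw [inner_sub_left, real_inner_smul_left, h2]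
      linarith) x y
  set D := g x - m • x - (g y - m • y) with hD
  have e : g x - g y - ((m + L) / 2) • (x - y) = D - ((L - m) / 2) • (x - y) := by
    rw [hD]
    module
  have hnn : 0 ≤ (L - m) / 2 := by linarith
  rw [e]
  refine le_of_sq_le_sq ?_ (by positivity)
  rw [norm_sub_sq_real, real_inner_smul_right, norm_smul, Real.norm_of_nonneg hnn]
  linarith

end Gradient

theorem PiLp.norm_le_mul_norm_of_forall_le {ι E : Type*} [Fintype ι] [SeminormedAddCommGroup E]
    {x y : PiLp 2 (fun _ : ι => E)} {r : ℝ} (hr : 0 ≤ r)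
    (h : ∀ i, ‖x i‖ ≤ r * ‖y i‖) : ‖x‖ ≤ r * ‖y‖ := by
  refine le_of_sq_le_sq ?_ (by positivity)
  rw [mul_pow, PiLp.norm_sq_eq_of_L2, PiLp.norm_sq_eq_of_L2, Finset.mul_sum]
  refine Finset.sum_le_sum fun i _ => ?_
  rw [← mul_pow]
  exact pow_le_pow_left₀ (norm_nonneg _) (h i) 2

section BlockAction

variable {ι E : Type*} [Fintype ι] [NormedAddCommGroup E] [InnerProductSpace ℝ E]

/-- The action of `A ⊗ I` on `E^ι`, with the `ℓ²` norm. -/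
def Matrix.blockAct (A : Matrix ι ι ℝ) (x : PiLp 2 (fun _ : ι => E)) : PiLp 2 (fun _ : ι => E) :=
  WithLp.toLp 2 fun i => ∑ j, A i j • x j

theorem Matrix.blockAct_mul (A B : Matrix ι ι ℝ) (x : PiLp 2 (fun _ : ι => E)) :
    (A * B).blockAct x = A.blockAct (B.blockAct x) := by
  ext1 i
  simp only [blockAct, Matrix.mul_apply, Finset.sum_smul, Finset.smul_sum, smul_smul]
  exact Finset.sum_comm

theorem Matrix.blockAct_sub (A : Matrix ι ι ℝ) (x y : PiLp 2 (fun _ : ι => E)) :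
    A.blockAct (x - y) = A.blockAct x - A.blockAct y := by
  ext1 i
  simp [blockAct, smul_sub]

variable [DecidableEq ι]

theorem Matrix.norm_blockAct_of_transpose_mul_self {A : Matrix ι ι ℝ} (hA : Aᵀ * A = 1)
    (x : PiLp 2 (fun _ : ι => E)) : ‖A.blockAct x‖ = ‖x‖ := by
  have hA' (j k : ι) : ∑ i, A i j * A i k = if j = k then 1 else 0 := by
    simpa [Matrix.mul_apply, Matrix.one_apply] using congrFun (congrFun hA j) k
  rw [← sq_eq_sq₀ (norm_nonneg _) (norm_nonneg _), PiLp.norm_sq_eq_of_L2, PiLp.norm_sq_eq_of_L2]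
  calc ∑ i, ‖(A.blockAct x) i‖ ^ 2
      = ∑ i, ∑ j, ∑ k, A i j * A i k * ⟪x j, x k⟫ := by
        refine Finset.sum_congr rfl fun i _ => ?_
        simp only [blockAct, ← real_inner_self_eq_norm_sq, sum_inner, inner_sum,
          real_inner_smul_left, real_inner_smul_right, mul_assoc]
        rw [Finset.sum_comm]
        exact Finset.sum_congr rfl fun j _ => Finset.sum_congr rfl fun k _ => mul_left_comm _ _ _
    _ = ∑ j, ∑ k, (∑ i, A i j * A i k) * ⟪x j, x k⟫ := by
        rw [Finset.sum_comm]
        refine Finset.sum_congr rfl fun j _ => ?_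
        rw [Finset.sum_comm]
        simp only [Finset.sum_mul]
    _ = ∑ j, ‖x j‖ ^ 2 := by simp [hA']

/-- If all eigenvalues of a symmetric matrix lie within distance `r` of `c`, then its action
differs from multiplication by `c` by an operator of norm at most `r`. -/
theorem Matrix.norm_blockAct_sub_smul_le {W V : Matrix ι ι ℝ} {lam : ι → ℝ} (hV : V * Vᵀ = 1)
    (hW : W = Vᵀ * Matrix.diagonal lam * V) {c r : ℝ} (hr : 0 ≤ r)
    (hlam : ∀ i, |lam i - c| ≤ r) (x : PiLp 2 (fun _ : ι => E)) :
    ‖W.blockAct x - c • x‖ ≤ r * ‖x‖ := by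
  have hV' : Vᵀ * V = 1 := mul_eq_one_comm.1 hV
  have hid : W.blockAct x - c • x
      = Vᵀ.blockAct ((Matrix.diagonal fun i => lam i - c).blockAct (V.blockAct x)) := by
    have hdiag : (Matrix.diagonal fun i => lam i - c) = Matrix.diagonal lam - c • 1 := by
      ext i j
      by_cases hij : i = j <;> simp [hij]
    have hWc : Vᵀ * (Matrix.diagonal fun i => lam i - c) * V = W - c • 1 := by
      rw [hdiag, mul_sub, sub_mul, ← hW, mul_smul_comm, mul_one, smul_mul_assoc, hV']
    rw [← Matrix.blockAct_mul, ← Matrix.blockAct_mul, hWc]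
    ext1 i
    simp [blockAct, sub_smul, Matrix.one_apply, ite_smul]
  rw [hid, norm_blockAct_of_transpose_mul_self (by simpa using hV),
    ← norm_blockAct_of_transpose_mul_self hV' x]
  refine PiLp.norm_le_mul_norm_of_forall_le hr fun i => ?_
  have : ((Matrix.diagonal fun i => lam i - c).blockAct (V.blockAct x)) i
      = (lam i - c) • (V.blockAct x) i := by
    simp [blockAct, Matrix.diagonal_apply, ite_smul]
  rw [this, norm_smul]
  exact mul_le_mul_of_nonneg_right (hlam i) (norm_nonneg _)

end BlockAction

section Noise

variable {Ω E : Type*} {mΩ : MeasurableSpace Ω} {P : Measure Ω} [NormedAddCommGroup E]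
  [InnerProductSpace ℝ E]

theorem MeasureTheory.MemLp.integrable_inner_of_two {u v : Ω → E} (hu : MemLp u 2 P)
    (hv : MemLp v 2 P) : Integrable (fun ω => ⟪u ω, v ω⟫) P := by
  refine Integrable.mono' (hu.norm.integrable_sq.add hv.norm.integrable_sq)
    (hu.aestronglyMeasurable.inner hv.aestronglyMeasurable) (.of_forall fun ω => ?_)
  have h1 := norm_inner_le_norm (𝕜 := ℝ) (u ω) (v ω)
  simp only [Pi.add_apply]
  nlinarith [sq_nonneg (‖u ω‖ - ‖v ω‖), sq_nonneg ‖u ω‖, sq_nonneg ‖v ω‖]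

theorem integral_norm_sub_smul_sq_le [CompleteSpace E] [IsProbabilityMeasure P]
    {m : MeasurableSpace Ω} (hm : m ≤ mΩ) {A w : Ω → E} (hA : StronglyMeasurable[m] A)
    (hA2 : MemLp A 2 P) (hw2 : MemLp w 2 P) (hw0 : P[w|m] =ᵐ[P] 0) {s : ℝ}
    (hvar : ∀ᵐ ω ∂P, (P[fun ω' => ‖w ω'‖ ^ 2|m]) ω ≤ s) (a : ℝ) :
    ∫ ω, ‖A ω - a • w ω‖ ^ 2 ∂P ≤ ∫ ω, ‖A ω‖ ^ 2 ∂P + a ^ 2 * s := by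
  have hAw := hA2.integrable_inner_of_two hw2
  have horth : ∫ ω, ⟪A ω, w ω⟫ ∂P = 0 := by
    rw [← integral_condExp hm]
    refine integral_eq_zero_of_ae ?_
    have := condExp_bilin_of_stronglyMeasurable_left (innerSL ℝ) hA
      hAw (hw2.integrable one_le_two)
    filter_upwards [this, hw0] with ω h1 h2
    refine h1.trans ?_
    simp [h2]
  have hs : ∫ ω, ‖w ω‖ ^ 2 ∂P ≤ s := by
    rw [← integral_condExp hm]
    simpa using integral_mono_ae integrable_condExp (integrable_const s) hvar
  have hexp (ω : Ω) :
      ‖A ω - a • w ω‖ ^ 2 = ‖A ω‖ ^ 2 - 2 * a * ⟪A ω, w ω⟫ + a ^ 2 * ‖w ω‖ ^ 2 := by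
    rw [norm_sub_sq_real, real_inner_smul_right, norm_smul, mul_pow, Real.norm_eq_abs, sq_abs]
    ring
  have hi1 := hA2.norm.integrable_sq
  have hi2 := hAw.const_mul (2 * a)
  have hi3 := hw2.norm.integrable_sq.const_mul (a ^ 2)
  simp_rw [hexp]
  rw [integral_add (f := fun ω => ‖A ω‖ ^ 2 - 2 * a * ⟪A ω, w ω⟫) (hi1.sub hi2) hi3,
    integral_sub hi1 hi2, integral_const_mul, integral_const_mul, horth]
  nlinarith [mul_le_mul_of_nonneg_left hs (sq_nonneg a)]

end Noise

section GradientStep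

variable {N : ℕ} {E : Type*} [NormedAddCommGroup E] [InnerProductSpace ℝ E]

/-- One noiseless step of decentralized gradient descent with mixing matrix `W`, stepsize `α` and
local gradients `g`. -/
def decentralizedGradientStep (W : Matrix (Fin N) (Fin N) ℝ) (α : ℝ) (g : Fin N → E → E)
    (x : PiLp 2 (fun _ : Fin N => E)) : PiLp 2 (fun _ : Fin N => E) :=
  WithLp.toLp 2 fun i => (∑ j, W i j • x j) - α • g i (x i)

theorem norm_decentralizedGradientStep_sub_le {W V : Matrix (Fin N) (Fin N) ℝ} {lam : Fin N → ℝ}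
    (hV : V * Vᵀ = 1) (hW : W = Vᵀ * Matrix.diagonal lam * V) {l m L α : ℝ}
    (hl : l ≤ 1) (hlam : ∀ i, l ≤ lam i ∧ lam i ≤ 1) (hmL : m ≤ L) (hα : 0 ≤ α)
    {g : Fin N → E → E}
    (hg : ∀ i x y, ‖g i x - g i y - ((m + L) / 2) • (x - y)‖ ≤ (L - m) / 2 * ‖x - y‖)
    (x y : PiLp 2 (fun _ : Fin N => E)) :
    ‖decentralizedGradientStep W α g x - decentralizedGradientStep W α g y‖
      ≤ max |1 - α * m| |l - α * L| * ‖x - y‖ := by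
  set c := (1 + l) / 2 with hc
  set q := (m + L) / 2
  let G : PiLp 2 (fun _ : Fin N => E) :=
    WithLp.toLp 2 fun i => g i (x i) - g i (y i) - q • (x i - y i)
  have hmix := Matrix.norm_blockAct_sub_smul_le hV hW (c := c) (r := (1 - l) / 2) (by linarith)
    (fun i => by rw [abs_le]; constructor <;> linarith [(hlam i).1, (hlam i).2]) (x - y)
  have hG : ‖G‖ ≤ (L - m) / 2 * ‖x - y‖ :=
    PiLp.norm_le_mul_norm_of_forall_le (by linarith) fun i => hg i (x i) (y i)
  have hsplit : decentralizedGradientStep W α g x - decentralizedGradientStep W α g y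
      = (W.blockAct (x - y) - c • (x - y)) - α • G + (c - α * q) • (x - y) := by
    rw [Matrix.blockAct_sub]
    ext1 i
    simp only [decentralizedGradientStep, Matrix.blockAct, G, PiLp.sub_apply, PiLp.add_apply,
      PiLp.smul_apply]
    module
  have hαG : ‖α • G‖ ≤ α * ((L - m) / 2 * ‖x - y‖) := by
    rw [norm_smul, Real.norm_of_nonneg hα]
    exact mul_le_mul_of_nonneg_left hG hα
  have hcoef : (1 - l) / 2 + α * ((L - m) / 2) + |c - α * q| ≤ max |1 - α * m| |l - α * L| := by
    rcases abs_cases (c - α * q) with ⟨h, -⟩ | ⟨h, -⟩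
    · refine le_max_of_le_left (le_trans (le_of_eq ?_) (le_abs_self _))
      rw [h]
      ring
    · refine le_max_of_le_right (le_trans (le_of_eq ?_) (neg_le_abs _))
      rw [h]
      ring
  rw [hsplit]
  refine (norm_add_le_of_le (norm_sub_le_of_le hmix hαG) (norm_smul_le _ _)).trans ?_
  rw [Real.norm_eq_abs]
  nlinarith [mul_le_mul_of_nonneg_right hcoef (norm_nonneg (x - y))]

theorem continuous_decentralizedGradientStep (W : Matrix (Fin N) (Fin N) ℝ) (α : ℝ)
    {g : Fin N → E → E} (hg : ∀ i, Continuous (g i)) :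
    Continuous (decentralizedGradientStep W α g) := by
  refine (PiLp.continuous_toLp 2 _).comp (continuous_pi fun i => ?_)
  have := hg i
  fun_prop

end GradientStep

/-- A sequence with `a (k + 1) ≤ q * a k + b` and `q ≠ 1` is bounded by the geometric recursion. -/
theorem le_geom_of_affine_recurrence {a : ℕ → ℝ} {q b : ℝ} (hq : 0 ≤ q) (hq1 : q ≠ 1)
    (h : ∀ k, a (k + 1) ≤ q * a k + b) (k : ℕ) :
    a k ≤ q ^ k * a 0 + (1 - q ^ k) / (1 - q) * b := by
  have hne : 1 - q ≠ 0 := sub_ne_zero.2 hq1.symm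
  induction k with
  | zero => simp
  | succ k ih =>
    refine (h k).trans ((add_le_add_left (mul_le_mul_of_nonneg_left ih hq) b).trans (le_of_eq ?_))
    field_simp
    ring

/-- **Theorem (D-SG convergence rate).**
Assume `λ_N^W > −1` and stepsize `0 < α < (1+λ_N^W)/L`.  Set
`ρ(α) := max {|1−αμ|, |λ_N^W − αL|}`.  Then `ρ(α) ∈ [0,1)` and for every `k ≥ 0`
the distributed stochastic gradient iterates satisfy
`E[‖x^{(k)} − x^∞‖²] ≤ ρ(α)^{2k} ‖x^{(0)} − x^∞‖² + ((1−ρ(α)^{2k})/(1−ρ(α)²)) σ² α² N`. -/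
theorem dsg_convergence_rate
    {N d : ℕ} (hN : 0 < N) (hd : 0 < d)
    (μ L α σ : ℝ) (hμ : 0 < μ) (hμL : μ ≤ L) (hσ : 0 ≤ σ)
    -- the symmetric doubly stochastic mixing matrix and its eigenvalues, in decreasing order
    (W : Matrix (Fin N) (Fin N) ℝ)
    (hWsymm : W.IsSymm)
    (hWnonneg : ∀ i j, 0 ≤ W i j)
    (hWrow : ∀ i, ∑ j, W i j = 1)
    (hWcol : ∀ j, ∑ i, W i j = 1)
    (lam : Fin N → ℝ) (V : Matrix (Fin N) (Fin N) ℝ)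
    (hV : V * Vᵀ = 1)
    (hWeig : W = Vᵀ * Matrix.diagonal lam * V)
    (hlamAnti : Antitone lam)
    (hlamTop : lam ⟨0, hN⟩ = 1)
    (lamN : ℝ) (hlamN : lamN = lam ⟨N - 1, Nat.sub_lt hN Nat.one_pos⟩)
    (hlamNgt : -1 < lamN)
    -- stepsize
    (hα0 : 0 < α) (hαlt : α < (1 + lamN) / L)
    -- the local objectives: μ-strongly convex with L-Lipschitz gradients
    (f : Fin N → EuclideanSpace ℝ (Fin d) → ℝ)
    (gradf : Fin N → EuclideanSpace ℝ (Fin d) → EuclideanSpace ℝ (Fin d))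
    (hgrad : ∀ i x, HasGradientAt (f i) (gradf i x) x)
    (hlip : ∀ i, LipschitzWith (Real.toNNReal L) (gradf i))
    (hconv : ∀ i, ConvexOn ℝ Set.univ (fun x => f i x - μ / 2 * ‖x‖ ^ 2))
    -- the fixed point x^∞ : solution of (I − 𝒲)x + α ∇F(x) = 0
    (xinf : PiLp 2 (fun _ : Fin N => EuclideanSpace ℝ (Fin d)))
    (hxinf : ∀ i, (xinf i - ∑ j, W i j • xinf j) + α • gradf i (xinf i) = 0)
    -- probability space, filtration and the D-SG iterates
    {Ω : Type} {mΩ : MeasurableSpace Ω} (P : Measure Ω) [IsProbabilityMeasure P]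
    (ℱ : ℕ → MeasurableSpace Ω) (hℱ : ∀ k, ℱ k ≤ mΩ) (hℱmono : Monotone ℱ)
    (X w : ℕ → Ω → PiLp 2 (fun _ : Fin N => EuclideanSpace ℝ (Fin d)))
    (x0 : PiLp 2 (fun _ : Fin N => EuclideanSpace ℝ (Fin d)))
    (hX0 : ∀ ω, X 0 ω = x0)
    (hXadapted : ∀ k, StronglyMeasurable[ℱ k] (X k))
    (hwmeas : ∀ k, StronglyMeasurable[ℱ (k + 1)] (w (k + 1)))
    (hrec : ∀ k ω i, X (k + 1) ω i =
      (∑ j, W i j • X k ω j) - α • gradf i (X k ω i) - α • w (k + 1) ω i)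
    -- the gradient noise: conditionally centered with conditional variance ≤ σ²N
    (hwmean : ∀ k, P[w (k + 1)|ℱ k] =ᵐ[P] 0)
    (hwL2 : ∀ k, Integrable (fun ω => ‖w (k + 1) ω‖ ^ 2) P)
    (hwvar : ∀ k, ∀ᵐ ω ∂P, (P[fun ω' => ‖w (k + 1) ω'‖ ^ 2|ℱ k]) ω ≤ σ ^ 2 * N) :
    0 ≤ max |1 - α * μ| |lamN - α * L| ∧ max |1 - α * μ| |lamN - α * L| < 1 ∧
      ∀ k : ℕ,
        ∫ ω, ‖X k ω - xinf‖ ^ 2 ∂P ≤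
          (max |1 - α * μ| |lamN - α * L|) ^ (2 * k) * ‖x0 - xinf‖ ^ 2 +
            (1 - (max |1 - α * μ| |lamN - α * L|) ^ (2 * k)) /
                (1 - (max |1 - α * μ| |lamN - α * L|) ^ 2) * σ ^ 2 * α ^ 2 * N := by
  have hL : 0 < L := hμ.trans_le hμL
  have hαL : α * L < 1 + lamN := (lt_div_iff₀ hL).1 hαlt
  have hlam (i : Fin N) : lamN ≤ lam i ∧ lam i ≤ 1 := by
    constructor
    · rw [hlamN]
      exact hlamAnti (Fin.le_def.2 (Nat.le_sub_one_of_lt i.2))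
    · rw [← hlamTop]
      exact hlamAnti (Fin.le_def.2 (Nat.zero_le _))
  have hlamN1 : lamN ≤ 1 := (hlam ⟨0, hN⟩).1.trans hlamTop.le
  have hαμ : 0 < α * μ := mul_pos hα0 hμ
  have hαμL : α * μ ≤ α * L := mul_le_mul_of_nonneg_left hμL hα0.le
  have hcontr := norm_decentralizedGradientStep_sub_le hV hWeig hlamN1 hlam hμL hα0.le
    fun i => norm_gradient_sub_smul_le hμ hμL (hgrad i) (hlip i) (hconv i)
  have hρ0 : 0 ≤ max |1 - α * μ| |lamN - α * L| := le_max_of_le_left (abs_nonneg _)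
  have hρ1 : max |1 - α * μ| |lamN - α * L| < 1 := by
    refine max_lt ?_ ?_ <;> rw [abs_lt] <;> constructor <;> linarith
  set ρ := max |1 - α * μ| |lamN - α * L|
  refine ⟨hρ0, hρ1, fun k => ?_⟩
  set T := decentralizedGradientStep W α gradf with hT
  have hTcont : Continuous T :=
    continuous_decentralizedGradientStep W α fun i => (hlip i).continuous
  have hfix : T xinf = xinf := by
    ext1 i
    have h := hxinf i
    rw [sub_add, sub_eq_zero] at h
    exact h.symm
  have hstep (k : ℕ) (ω : Ω) :
      X (k + 1) ω - xinf = (T (X k ω) - T xinf) - α • w (k + 1) ω := by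
    rw [hfix]
    ext1 i
    simp only [PiLp.sub_apply, PiLp.smul_apply, hrec k ω i, hT, decentralizedGradientStep]
    abel
  have hw2 (k : ℕ) : MemLp (w (k + 1)) 2 P :=
    (memLp_two_iff_integrable_sq_norm ((hwmeas k).mono (hℱ _)).aestronglyMeasurable).2 (hwL2 k)
  have hTmeas (k : ℕ) : StronglyMeasurable[ℱ k] fun ω => T (X k ω) - T xinf :=
    (hTcont.comp_stronglyMeasurable (hXadapted k)).sub stronglyMeasurable_const
  have hT2 (k : ℕ) (h : MemLp (fun ω => X k ω - xinf) 2 P) :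
      MemLp (fun ω => T (X k ω) - T xinf) 2 P :=
    h.of_le_mul ((hTmeas k).mono (hℱ k)).aestronglyMeasurable
      (.of_forall fun ω => hcontr (X k ω) xinf)
  have hX2 (k : ℕ) : MemLp (fun ω => X k ω - xinf) 2 P := by
    induction k with
    | zero =>
      simp only [hX0]
      exact memLp_const _
    | succ k ih =>
      simp only [hstep]
      exact (hT2 k ih).sub ((hw2 k).const_smul α)
  have hrecur (k : ℕ) : ∫ ω, ‖X (k + 1) ω - xinf‖ ^ 2 ∂P
      ≤ ρ ^ 2 * ∫ ω, ‖X k ω - xinf‖ ^ 2 ∂P + α ^ 2 * (σ ^ 2 * N) := by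
    simp only [hstep]
    refine (integral_norm_sub_smul_sq_le (hℱ k) (hTmeas k) (hT2 k (hX2 k)) (hw2 k) (hwmean k)
      (hwvar k) α).trans ?_
    gcongr
    rw [← integral_const_mul]
    refine integral_mono (hT2 k (hX2 k)).norm.integrable_sq
      ((hX2 k).norm.integrable_sq.const_mul _) fun ω => ?_
    simp only [← mul_pow]
    exact pow_le_pow_left₀ (norm_nonneg _) (hcontr (X k ω) xinf) 2
  have hbound := le_geom_of_affine_recurrence
    (a := fun k => ∫ ω, ‖X k ω - xinf‖ ^ 2 ∂P) (sq_nonneg ρ)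
    (pow_lt_one₀ hρ0 hρ1 two_ne_zero).ne hrecur k
  simp only [hX0, integral_const, probReal_univ, one_smul, ← pow_mul] at hbound
  refine hbound.trans (le_of_eq ?_)
  ring
end

section
/- Assume 0 < α ≤ 2/(L+μ), α < (1+λ_N^W)/L, μα(1+λ_N^W−αL) < 1, γ² ≠ 1 − αμ(1 − αL/2), and ‖x^∞ − x^*‖ ≤ √N C₁ α/(1−γ). Define D² := 4L²‖x^{(0)}−x^*‖² + 8L²C₁²α²N/(1−γ)² + 2L²ασ²N/(μ(1+λ_N^W−αL)) + 4‖∇F(x^*)‖², and let x̄^{(k)} := (1/N)Σ_{i=1}^N x_i^{(k)} be the node average of the D-SG iterates. Then for every k ≥ 0, E[‖x̄^{(k)} − x_*‖²] ≤ 8(α/(μ(1−αL/2)) + (1+αL)²/(μ²(1−αL/2)²))·(L²D²α²/(N(1−γ)²) + L²σ²α²/(1−γ²)) + 8·((γ^{2k} − (1−αμ(1−αL/2))^k)/(γ² − (1−αμ(1−αL/2))))·(L²γ²/N)·‖x^{(0)}‖² + 2(1−αμ)^{2k}‖x̄^{(0)} − x_*‖² + ((1−(1−αμ)^{2k})/(μ(1−αμ/2)))·ασ²/N.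 -/
open MeasureTheory Filter Real ProbabilityTheory
open scoped RealInnerProductSpace ENNReal NNReal Matrix

section ConvexGradient

variable {E : Type*} [NormedAddCommGroup E] [InnerProductSpace ℝ E] [CompleteSpace E]

lemma HasGradientAt.hasDerivAt_comp_line {f : E → ℝ} {g x v : E} {t : ℝ}
    (h : HasGradientAt f g (x + t • v)) :
    HasDerivAt (fun s : ℝ => f (x + s • v)) ⟪g, v⟫ t := by
  have h1 : HasDerivAt (fun s : ℝ => x + s • v) v t := by
    simpa using ((hasDerivAt_id t).smul_const v).const_add x
  simpa using! h.hasFDerivAt.comp_hasDerivAt t h1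

/-- First-order lower bound for a strongly convex differentiable function. -/
lemma strongConvex_first_order {f : E → ℝ} {μ : ℝ} {g x : E} (hg : HasGradientAt f g x)
    (hconv : ConvexOn ℝ Set.univ (fun x => f x - μ / 2 * ‖x‖ ^ 2)) (y : E) :
    f x + ⟪g, y - x⟫ + μ / 2 * ‖y - x‖ ^ 2 ≤ f y := by
  have hc := hconv.comp_affineMap (AffineMap.lineMap (k := ℝ) x y)
  have hd : HasDerivAt ((fun x => f x - μ / 2 * ‖x‖ ^ 2) ∘ (AffineMap.lineMap (k := ℝ) x y))
      (⟪g, y - x⟫ - μ / 2 * (2 * ⟪x, y - x⟫)) 0 := by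
    have h1 : HasDerivAt (fun s : ℝ => x + s • (y - x)) (y - x) 0 := by
      simpa using ((hasDerivAt_id (0 : ℝ)).smul_const (y - x)).const_add x
    have h2 := h1.norm_sq
    have h3 := HasGradientAt.hasDerivAt_comp_line (v := y - x) (t := 0) (by simpa using hg)
    have h4 := h3.sub (h2.const_mul (μ / 2))
    simp only [zero_smul, add_zero] at h4
    refine h4.congr_of_eventuallyEq (Eventually.of_forall fun s => ?_)
    simp [AffineMap.lineMap_apply, add_comm]
  have h := hc.le_slope_of_hasDerivAt (x := 0) (y := 1) (by simp) (by simp) one_pos hd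
  have h5 : ‖y - x‖ ^ 2 = ‖y‖ ^ 2 - 2 * ⟪x, y⟫ + ‖x‖ ^ 2 := by
    rw [norm_sub_sq_real, real_inner_comm]
  have h6 : ⟪x, y - x⟫ = ⟪x, y⟫ - ‖x‖ ^ 2 := by
    rw [inner_sub_right, real_inner_self_eq_norm_sq]
  simp [slope_def_field] at h
  rw [h5]
  rw [h6] at h
  linarith

/-- The descent lemma for a function with Lipschitz gradient. -/
lemma lipschitzGradient_descent {f : E → ℝ} {g : E → E} {L : ℝ}
    (hg : ∀ x, HasGradientAt f (g x) x) (hlip : ∀ x y, ‖g x - g y‖ ≤ L * ‖x - y‖) (x v : E) :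
    f (x + v) ≤ f x + ⟪g x, v⟫ + L / 2 * ‖v‖ ^ 2 := by
  have hd : ∀ t : ℝ, HasDerivAt
      (fun s : ℝ => f (x + s • v) - s * ⟪g x, v⟫ - L / 2 * ‖v‖ ^ 2 * s ^ 2)
      (⟪g (x + t • v), v⟫ - ⟪g x, v⟫ - L / 2 * ‖v‖ ^ 2 * (2 * t)) t := fun t => by
    have h := (((hg (x + t • v)).hasDerivAt_comp_line).sub
      ((hasDerivAt_id t).mul_const ⟪g x, v⟫)).sub
      ((hasDerivAt_pow 2 t).const_mul (L / 2 * ‖v‖ ^ 2))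
    simpa using! h
  have hanti := antitoneOn_of_deriv_nonpos (convex_Icc (0 : ℝ) 1)
    (fun t _ => (hd t).continuousAt.continuousWithinAt)
    (fun t _ => (hd t).differentiableAt.differentiableWithinAt)
    (fun t ht => by
      rw [(hd t).deriv]
      have ht0 : 0 ≤ t := by
        rw [interior_Icc] at ht
        exact ht.1.le
      have h1 : ⟪g (x + t • v) - g x, v⟫ ≤ L * (t * ‖v‖) * ‖v‖ := by
        refine (real_inner_le_norm _ _).trans ?_
        have := hlip (x + t • v) x
        rw [add_sub_cancel_left, norm_smul, Real.norm_of_nonneg ht0] at this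
        gcongr
      rw [inner_sub_left] at h1
      nlinarith)
  have h := hanti (Set.left_mem_Icc.2 zero_le_one) (Set.right_mem_Icc.2 zero_le_one) zero_le_one
  simp at h
  linarith

/-- The interpolation inequality for the gradient of a `μ`-strongly convex function with
`L`-Lipschitz gradient. -/
lemma strongConvex_interpolation {f : E → ℝ} {g : E → E} {μ L : ℝ} (hμL : μ ≤ L)
    (hg : ∀ x, HasGradientAt f (g x) x) (hlip : ∀ x y, ‖g x - g y‖ ≤ L * ‖x - y‖)
    (hconv : ConvexOn ℝ Set.univ (fun x => f x - μ / 2 * ‖x‖ ^ 2)) (x y : E) :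
    ‖g x - g y‖ ^ 2 + μ * L * ‖x - y‖ ^ 2 ≤ (L + μ) * ⟪g x - g y, x - y⟫ := by
  have key : ∀ (x y : E) (t : ℝ),
      f x + ⟪g x, y - x⟫ + μ / 2 * ‖y - x‖ ^ 2 +
        (t - (L - μ) / 2 * t ^ 2) * ‖g y - g x - μ • (y - x)‖ ^ 2 ≤ f y := by
    intro x y t
    set G := g y - g x - μ • (y - x) with hG
    have h1 := strongConvex_first_order (hg x) hconv (y - t • G)
    have h2 := lipschitzGradient_descent hg hlip y (-(t • G))
    have h3 : y - t • G - x = (y - x) - t • G := by abel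
    rw [h3, inner_sub_right, norm_sub_sq_real] at h1
    rw [← sub_eq_add_neg, inner_neg_right, norm_neg] at h2
    simp only [inner_smul_right, norm_smul, mul_pow, Real.norm_eq_abs, sq_abs] at h1 h2
    have h4 : ‖G‖ ^ 2 = ⟪g y, G⟫ - ⟪g x, G⟫ - μ * ⟪y - x, G⟫ := by
      rw [← real_inner_self_eq_norm_sq]
      conv_lhs => enter [2]; rw [hG]
      rw [inner_sub_left, inner_sub_left, inner_smul_left]
      simp
    linear_combination h1 + h2 + t * h4
  have main : ∀ t : ℝ, μ * ‖x - y‖ ^ 2 +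
      (2 * t - (L - μ) * t ^ 2) * ‖g x - g y - μ • (x - y)‖ ^ 2 ≤ ⟪g x - g y, x - y⟫ := by
    intro t
    have h1 := key x y t
    have h2 := key y x t
    have h3 : ‖g y - g x - μ • (y - x)‖ = ‖g x - g y - μ • (x - y)‖ := by
      rw [← norm_neg]
      congr 1
      module
    have h4 : ⟪g x, y - x⟫ = -⟪g x, x - y⟫ := by rw [← inner_neg_right, neg_sub]
    rw [h3, h4, norm_sub_rev y x] at h1
    rw [inner_sub_left]
    linarith
  have hexp : ‖g x - g y - μ • (x - y)‖ ^ 2 =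
      ‖g x - g y‖ ^ 2 - 2 * μ * ⟪g x - g y, x - y⟫ + μ ^ 2 * ‖x - y‖ ^ 2 := by
    rw [norm_sub_sq_real, inner_smul_right, norm_smul, mul_pow, Real.norm_eq_abs, sq_abs]
    ring
  rcases hμL.eq_or_lt with rfl | hlt
  · have h0 : ‖g x - g y - μ • (x - y)‖ ^ 2 ≤ 0 := by
      by_contra! hpos
      set c := ⟪g x - g y, x - y⟫
      have := main ((c - μ * ‖x - y‖ ^ 2 + 1) / (2 * ‖g x - g y - μ • (x - y)‖ ^ 2))
      rw [sub_self, zero_mul, sub_zero] at this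
      rw [← mul_div_assoc, mul_div_mul_left _ _ two_ne_zero, div_mul_cancel₀ _ hpos.ne'] at this
      linarith
    rw [hexp] at h0
    nlinarith
  · have hpos : 0 < L - μ := sub_pos.2 hlt
    have h := main (1 / (L - μ))
    have h1 : (2 * (1 / (L - μ)) - (L - μ) * (1 / (L - μ)) ^ 2) = 1 / (L - μ) := by
      field_simp
      ring
    rw [h1, hexp, one_div, inv_mul_eq_div, ← le_sub_iff_add_le', div_le_iff₀ hpos] at h
    nlinarith

end ConvexGradient

/-- Strong monotonicity, cocoercivity and Lipschitz continuity from the interpolation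
inequality. -/
lemma bounds_of_interpolation {E : Type*} [NormedAddCommGroup E] [InnerProductSpace ℝ E]
    {μ L : ℝ} (hμ : 0 < μ) (hμL : μ ≤ L) {g z : E}
    (h : ‖g‖ ^ 2 + μ * L * ‖z‖ ^ 2 ≤ (L + μ) * ⟪g, z⟫) :
    μ * ‖z‖ ^ 2 ≤ ⟪g, z⟫ ∧ ‖g‖ ^ 2 ≤ L * ⟪g, z⟫ ∧ ‖g‖ ≤ L * ‖z‖ := by
  have h1 := real_inner_le_norm g z
  have hg := norm_nonneg g
  have hz := norm_nonneg z
  have h0 : (‖g‖ - μ * ‖z‖) * (‖g‖ - L * ‖z‖) ≤ 0 := by nlinarith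
  have h2 : μ * ‖z‖ ≤ L * ‖z‖ := by gcongr
  have hlow : μ * ‖z‖ ≤ ‖g‖ := by
    by_contra! hlt
    nlinarith
  have hup : ‖g‖ ≤ L * ‖z‖ := by
    by_contra! hlt
    nlinarith
  have hsum : 0 < L + μ := by linarith
  refine ⟨?_, ?_, hup⟩
  · have h3 : (μ * ‖z‖) ^ 2 ≤ ‖g‖ ^ 2 := by gcongr
    refine le_of_mul_le_mul_left ?_ hsum
    nlinarith
  · have h3 : ‖g‖ ^ 2 ≤ (L * ‖z‖) ^ 2 := by gcongr
    refine le_of_mul_le_mul_left ?_ hsum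
    nlinarith

lemma norm_sub_sub_smul_sq_le {H : Type*} [NormedAddCommGroup H] [InnerProductSpace ℝ H]
    {z p g : H} {α μ L β : ℝ} (hα : 0 ≤ α) (hL : 0 ≤ L) (hβ : 0 ≤ β)
    (hstep : α * L + β ≤ 2)
    (hp0 : 0 ≤ ⟪p, z⟫) (hp : ‖p‖ ^ 2 ≤ β * ⟪p, z⟫)
    (hg0 : 0 ≤ ⟪g, z⟫) (hg : ‖g‖ ^ 2 ≤ L * ⟪g, z⟫) (hμ : μ * ‖z‖ ^ 2 ≤ ⟪g, z⟫) :
    ‖z - p - α • g‖ ^ 2 ≤ (1 - α * μ * (2 - β - α * L)) * ‖z‖ ^ 2 := by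
  have hpg : 2 * ⟪p, g⟫ ≤ L * ⟪p, z⟫ + β * ⟪g, z⟫ := by
    refine le_of_sq_le_sq ?_ (by positivity)
    have h1 : ⟪p, g⟫ ^ 2 ≤ ‖p‖ ^ 2 * ‖g‖ ^ 2 := by
      rw [← mul_pow, ← sq_abs]
      gcongr
      exact abs_real_inner_le_norm p g
    have h2 : ‖p‖ ^ 2 * ‖g‖ ^ 2 ≤ (β * ⟪p, z⟫) * (L * ⟪g, z⟫) := by gcongr
    nlinarith [sq_nonneg (L * ⟪p, z⟫ - β * ⟪g, z⟫)]
  have hexp : ‖z - p - α • g‖ ^ 2 = ‖z‖ ^ 2 - 2 * ⟪p, z⟫ + ‖p‖ ^ 2 - 2 * α * ⟪g, z⟫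
      + 2 * α * ⟪p, g⟫ + α ^ 2 * ‖g‖ ^ 2 := by
    rw [norm_sub_sq_real, norm_sub_sq_real, inner_smul_right, norm_smul, mul_pow,
      Real.norm_eq_abs, sq_abs, inner_sub_left, real_inner_comm p z, real_inner_comm g z]
    ring
  rw [hexp]
  have h3 : α * (2 * ⟪p, g⟫) ≤ α * (L * ⟪p, z⟫ + β * ⟪g, z⟫) := by gcongr
  have h4 : α ^ 2 * ‖g‖ ^ 2 ≤ α ^ 2 * (L * ⟪g, z⟫) := by gcongr
  have h5 : 0 ≤ (2 - β - α * L) * ⟪p, z⟫ := mul_nonneg (by linarith) hp0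
  have h6 : 0 ≤ α * (2 - β - α * L) * (⟪g, z⟫ - μ * ‖z‖ ^ 2) :=
    mul_nonneg (mul_nonneg hα (by linarith)) (by linarith)
  nlinarith

lemma norm_sub_smul_le_of_interpolation {H : Type*} [NormedAddCommGroup H]
    [InnerProductSpace ℝ H] {z g : H} {α μ L : ℝ} (hα0 : 0 ≤ α) (hμ : 0 < μ) (hμL : μ ≤ L)
    (hα : α ≤ 2 / (L + μ)) (h : ‖g‖ ^ 2 + μ * L * ‖z‖ ^ 2 ≤ (L + μ) * ⟪g, z⟫)
    (hmono : μ * ‖z‖ ^ 2 ≤ ⟪g, z⟫) :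
    ‖z - α • g‖ ≤ (1 - α * μ) * ‖z‖ := by
  have hs : 0 < L + μ := by linarith
  rw [le_div_iff₀ hs] at hα
  have hq : 0 ≤ 1 - α * μ := by nlinarith
  refine le_of_sq_le_sq ?_ (by positivity)
  rw [norm_sub_sq_real, inner_smul_right, norm_smul, mul_pow, Real.norm_eq_abs, sq_abs,
    real_inner_comm]
  have h1 : α ^ 2 * (‖g‖ ^ 2 + μ * L * ‖z‖ ^ 2) ≤ α ^ 2 * ((L + μ) * ⟪g, z⟫) := by gcongr
  have h2 : 0 ≤ (α * (2 - α * (L + μ))) * (⟪g, z⟫ - μ * ‖z‖ ^ 2) :=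
    mul_nonneg (mul_nonneg hα0 (by linarith)) (by linarith)
  nlinarith

section Mixing

variable {N : ℕ} {E : Type*} [NormedAddCommGroup E] [InnerProductSpace ℝ E]

/-- The operator `A ⊗ I` acting blockwise on `E ^ N`. -/
noncomputable def mixing (A : Matrix (Fin N) (Fin N) ℝ) :
    PiLp 2 (fun _ : Fin N => E) →L[ℝ] PiLp 2 (fun _ : Fin N => E) :=
  (PiLp.continuousLinearEquiv 2 ℝ (fun _ : Fin N => E)).symm.toContinuousLinearMap ∘L
    ContinuousLinearMap.pi (fun i => ∑ j, A i j • PiLp.proj 2 (fun _ : Fin N => E) j)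

@[simp]
lemma mixing_apply (A : Matrix (Fin N) (Fin N) ℝ) (z : PiLp 2 (fun _ : Fin N => E)) (i : Fin N) :
    mixing A z i = ∑ j, A i j • z j := by
  simp [mixing]

lemma mixing_mul (A B : Matrix (Fin N) (Fin N) ℝ) (z : PiLp 2 (fun _ : Fin N => E)) :
    mixing (A * B) z = mixing A (mixing B z) := by
  ext i : 1
  simp only [mixing_apply, Matrix.mul_apply, Finset.sum_smul, Finset.smul_sum, mul_smul]
  exact Finset.sum_comm

lemma mixing_one (z : PiLp 2 (fun _ : Fin N => E)) : mixing 1 z = z := by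
  ext i : 1
  simp [Matrix.one_apply]

lemma mixing_diagonal_apply (lam : Fin N → ℝ) (z : PiLp 2 (fun _ : Fin N => E)) (i : Fin N) :
    mixing (Matrix.diagonal lam) z i = lam i • z i := by
  simp [Matrix.diagonal_apply]

lemma inner_mixing_left (A : Matrix (Fin N) (Fin N) ℝ) (x y : PiLp 2 (fun _ : Fin N => E)) :
    ⟪mixing A x, y⟫ = ⟪x, mixing Aᵀ y⟫ := by
  simp only [PiLp.inner_apply, mixing_apply, sum_inner, inner_sum, inner_smul_left,
    inner_smul_right, Matrix.transpose_apply]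
  exact Finset.sum_comm

variable {W V : Matrix (Fin N) (Fin N) ℝ} {lam : Fin N → ℝ}

lemma norm_mixing_sq_of_orthogonal (hV : V * Vᵀ = 1) (z : PiLp 2 (fun _ : Fin N => E)) :
    ‖mixing V z‖ ^ 2 = ‖z‖ ^ 2 := by
  rw [← real_inner_self_eq_norm_sq, inner_mixing_left, ← mixing_mul,
    mul_eq_one_comm.1 hV, mixing_one, real_inner_self_eq_norm_sq]

lemma mixing_spectral (hV : V * Vᵀ = 1) (hW : W = Vᵀ * Matrix.diagonal lam * V)
    (z : PiLp 2 (fun _ : Fin N => E)) :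
    mixing V (mixing W z) = mixing (Matrix.diagonal lam) (mixing V z) := by
  rw [← mixing_mul, ← mixing_mul, hW, ← mul_assoc, ← mul_assoc, hV, one_mul]

lemma norm_mixing_sq (hV : V * Vᵀ = 1) (hW : W = Vᵀ * Matrix.diagonal lam * V)
    (z : PiLp 2 (fun _ : Fin N => E)) :
    ‖mixing W z‖ ^ 2 = ∑ i, lam i ^ 2 * ‖mixing V z i‖ ^ 2 := by
  rw [← norm_mixing_sq_of_orthogonal hV, mixing_spectral hV hW, PiLp.norm_sq_eq_of_L2]
  simp only [mixing_diagonal_apply, norm_smul, mul_pow, Real.norm_eq_abs, sq_abs]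

/-- The Laplacian `I - W` is positive and cocoercive when the spectrum of `W` lies in `[l, 1]`. -/
lemma laplacian_bounds (hV : V * Vᵀ = 1) (hW : W = Vᵀ * Matrix.diagonal lam * V) {l : ℝ}
    (hl : ∀ i, l ≤ lam i) (h1 : ∀ i, lam i ≤ 1) (z : PiLp 2 (fun _ : Fin N => E)) :
    0 ≤ ⟪z - mixing W z, z⟫ ∧ ‖z - mixing W z‖ ^ 2 ≤ (1 - l) * ⟪z - mixing W z, z⟫ := by
  have hB : z - mixing W z = mixing (Vᵀ * Matrix.diagonal (fun i => 1 - lam i) * V) z := by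
    have : Vᵀ * Matrix.diagonal (fun i => 1 - lam i) * V = 1 - W := by
      rw [← Matrix.diagonal_sub, Matrix.diagonal_one, mul_sub, sub_mul, mul_one,
        mul_eq_one_comm.1 hV, hW]
    rw [this]
    ext i : 1
    simp [Matrix.sub_apply, sub_smul, Matrix.one_apply]
  have hinner : ⟪z - mixing W z, z⟫ = ∑ i, (1 - lam i) * ‖mixing V z i‖ ^ 2 := by
    rw [hB, mul_assoc, mixing_mul, inner_mixing_left, Matrix.transpose_transpose, mixing_mul,
      PiLp.inner_apply]
    simp only [mixing_diagonal_apply, inner_smul_left, real_inner_self_eq_norm_sq]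
    simp
  have hnorm : ‖z - mixing W z‖ ^ 2 = ∑ i, (1 - lam i) ^ 2 * ‖mixing V z i‖ ^ 2 := by
    rw [hB, norm_mixing_sq hV rfl]
  rw [hnorm, hinner, Finset.mul_sum]
  refine ⟨Finset.sum_nonneg fun i _ => mul_nonneg (by linarith [h1 i]) (by positivity),
    Finset.sum_le_sum fun i _ => ?_⟩
  rw [← mul_assoc, sq]
  have := h1 i
  have := hl i
  gcongr

/-- `W` contracts vectors with zero mean by the second largest eigenvalue modulus. -/
lemma norm_mixing_le_of_sum_eq_zero (hV : V * Vᵀ = 1)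
    (hW : W = Vᵀ * Matrix.diagonal lam * V) (hrow : ∀ i, ∑ j, W i j = 1) {i₀ : Fin N} {γ : ℝ}
    (hγ0 : 0 ≤ γ) (hγ1 : γ < 1) (hγ : ∀ i, i ≠ i₀ → |lam i| ≤ γ)
    (z : PiLp 2 (fun _ : Fin N => E)) (hz : ∑ i, z i = 0) :
    ‖mixing W z‖ ≤ γ * ‖z‖ := by
  have hones : ∀ i, (V *ᵥ 1) i = lam i * (V *ᵥ 1) i := by
    intro i
    have h1 : W *ᵥ 1 = 1 := by
      ext i
      simp [Matrix.mulVec, dotProduct, hrow]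
    have h2 : V *ᵥ (W *ᵥ 1) = Matrix.diagonal lam *ᵥ (V *ᵥ 1) := by
      rw [Matrix.mulVec_mulVec, Matrix.mulVec_mulVec, hW, ← mul_assoc, ← mul_assoc, hV, one_mul]
    rw [h1] at h2
    exact (congrFun h2 i).trans (Matrix.mulVec_diagonal _ _ _)
  have hzero : ∀ i, i ≠ i₀ → (V *ᵥ 1) i = 0 := by
    intro i hi
    have h1 := hones i
    have h2 : lam i < 1 := (le_abs_self _).trans_lt ((hγ i hi).trans_lt hγ1)
    have h3 : (1 - lam i) * (V *ᵥ 1) i = 0 := by linarith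
    exact (mul_eq_zero.1 h3).resolve_left (by linarith)
  have hcol : ∀ j, V i₀ j * (V *ᵥ 1) i₀ = 1 := by
    intro j
    have h1 : Vᵀ *ᵥ (V *ᵥ 1) = 1 := by
      rw [Matrix.mulVec_mulVec, mul_eq_one_comm.1 hV, Matrix.one_mulVec]
    have h2 := congrFun h1 j
    rw [Matrix.mulVec, dotProduct, Finset.sum_eq_single i₀] at h2
    · simpa using h2
    · intro i _ hi
      rw [hzero i hi, mul_zero]
    · simp
  have hhat : mixing V z i₀ = 0 := by
    have h1 : (V *ᵥ 1) i₀ • mixing V z i₀ = 0 := by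
      rw [mixing_apply, Finset.smul_sum, ← hz]
      refine Finset.sum_congr rfl fun j _ => ?_
      rw [smul_smul, mul_comm, hcol, one_smul]
    refine (smul_eq_zero.1 h1).resolve_left fun h0 => ?_
    have := hcol i₀
    rw [h0, mul_zero] at this
    exact zero_ne_one this
  refine le_of_sq_le_sq ?_ (by positivity)
  rw [norm_mixing_sq hV hW, mul_pow, ← norm_mixing_sq_of_orthogonal hV, PiLp.norm_sq_eq_of_L2,
    Finset.mul_sum]
  refine Finset.sum_le_sum fun i _ => ?_
  by_cases hi : i = i₀
  · rw [hi, hhat]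
    simp
  · refine mul_le_mul_of_nonneg_right ?_ (by positivity)
    exact sq_le_sq' (abs_le.1 (hγ i hi)).1 (abs_le.1 (hγ i hi)).2

/-- The average of the blocks. -/
noncomputable def blockMean : PiLp 2 (fun _ : Fin N => E) →L[ℝ] E :=
  (1 / (N : ℝ)) • ∑ j, PiLp.proj 2 (fun _ : Fin N => E) j

lemma blockMean_apply (z : PiLp 2 (fun _ : Fin N => E)) :
    blockMean z = (1 / (N : ℝ)) • ∑ j, z j := by
  simp [blockMean]

/-- The deviation of the blocks from their average. -/
noncomputable def blockDev :
    PiLp 2 (fun _ : Fin N => E) →L[ℝ] PiLp 2 (fun _ : Fin N => E) :=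
  ContinuousLinearMap.id ℝ _ -
    (PiLp.continuousLinearEquiv 2 ℝ (fun _ : Fin N => E)).symm.toContinuousLinearMap ∘L
      ContinuousLinearMap.pi (fun _ => blockMean)

@[simp]
lemma blockDev_apply (z : PiLp 2 (fun _ : Fin N => E)) (i : Fin N) :
    blockDev z i = z i - blockMean z := by
  simp [blockDev]

lemma sum_blocks (z : PiLp 2 (fun _ : Fin N => E)) : ∑ j, z j = (N : ℝ) • blockMean z := by
  rcases N.eq_zero_or_pos with rfl | hN
  · simp
  · rw [blockMean_apply, smul_smul, mul_one_div_cancel (by positivity), one_smul]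

lemma sum_blockDev (z : PiLp 2 (fun _ : Fin N => E)) : ∑ i, blockDev z i = 0 := by
  simp [Finset.sum_sub_distrib, sum_blocks, Nat.cast_smul_eq_nsmul]

lemma norm_blockDev_sq (z : PiLp 2 (fun _ : Fin N => E)) :
    ‖blockDev z‖ ^ 2 = ‖z‖ ^ 2 - N * ‖blockMean z‖ ^ 2 := by
  rw [PiLp.norm_sq_eq_of_L2, PiLp.norm_sq_eq_of_L2]
  simp only [blockDev_apply, norm_sub_sq_real]
  rw [Finset.sum_add_distrib, Finset.sum_sub_distrib, ← Finset.mul_sum, ← sum_inner, sum_blocks,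
    inner_smul_left, real_inner_self_eq_norm_sq]
  simp
  ring

lemma norm_blockDev_le (z : PiLp 2 (fun _ : Fin N => E)) : ‖blockDev z‖ ≤ ‖z‖ := by
  refine le_of_sq_le_sq ?_ (norm_nonneg z)
  rw [norm_blockDev_sq]
  have : 0 ≤ (N : ℝ) * ‖blockMean z‖ ^ 2 := by positivity
  linarith

lemma card_mul_norm_blockMean_sq_le (z : PiLp 2 (fun _ : Fin N => E)) :
    N * ‖blockMean z‖ ^ 2 ≤ ‖z‖ ^ 2 := by
  have := norm_blockDev_sq z
  have : 0 ≤ ‖blockDev z‖ ^ 2 := by positivity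
  linarith

lemma blockMean_mixing (hcol : ∀ j, ∑ i, W i j = 1) (z : PiLp 2 (fun _ : Fin N => E)) :
    blockMean (mixing W z) = blockMean z := by
  rw [blockMean_apply, blockMean_apply]
  congr 1
  simp only [mixing_apply]
  rw [Finset.sum_comm]
  simp [← Finset.sum_smul, hcol]

lemma blockDev_mixing (hrow : ∀ i, ∑ j, W i j = 1) (hcol : ∀ j, ∑ i, W i j = 1)
    (z : PiLp 2 (fun _ : Fin N => E)) : blockDev (mixing W z) = mixing W (blockDev z) := by
  ext i : 1
  simp [blockMean_mixing hcol, smul_sub, Finset.sum_sub_distrib, ← Finset.sum_smul, hrow]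

end Mixing

section LpNormTwo

variable {Ω : Type*} {mΩ : MeasurableSpace Ω} {P : Measure Ω}
  {H : Type*} [NormedAddCommGroup H]

lemma lpNorm_two_sq {A : Ω → H} (hA : MemLp A 2 P) :
    lpNorm A 2 P ^ 2 = ∫ ω, ‖A ω‖ ^ 2 ∂P := by
  rw [lpNorm_eq_integral_norm_rpow_toReal two_ne_zero ENNReal.ofNat_ne_top
    hA.aestronglyMeasurable]
  simp only [ENNReal.toReal_ofNat, Real.rpow_ofNat]
  rw [← Real.rpow_natCast, ← Real.rpow_mul (integral_nonneg fun ω => by positivity)]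
  norm_num

lemma lpNorm_two_le_add {F F' : Type*} [NormedAddCommGroup F] [NormedAddCommGroup F']
    {A : Ω → H} {B : Ω → F} {C : Ω → F'} (hA : MemLp A 2 P) (hB : MemLp B 2 P)
    (hC : MemLp C 2 P) {b c : ℝ} (hb : 0 ≤ b) (hc : 0 ≤ c)
    (h : ∀ ω, ‖A ω‖ ≤ b * ‖B ω‖ + c * ‖C ω‖) :
    lpNorm A 2 P ≤ b * lpNorm B 2 P + c * lpNorm C 2 P := by
  have h1 : lpNorm A 2 P ≤ lpNorm ((b • fun ω => ‖B ω‖) + c • fun ω => ‖C ω‖) 2 P := by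
    rw [← toReal_eLpNorm hA.aestronglyMeasurable,
      ← toReal_eLpNorm ((hB.norm.const_smul b).add (hC.norm.const_smul c)).aestronglyMeasurable]
    refine ENNReal.toReal_mono
      ((hB.norm.const_smul b).add (hC.norm.const_smul c)).eLpNorm_ne_top ?_
    refine eLpNorm_mono_real fun ω => ?_
    simpa using h ω
  refine h1.trans ((lpNorm_add_le (hB.norm.const_smul b) one_le_two).trans_eq ?_)
  rw [lpNorm_const_smul, lpNorm_const_smul, lpNorm_norm hB.aestronglyMeasurable,
    lpNorm_norm hC.aestronglyMeasurable]
  simp [abs_of_nonneg hb, abs_of_nonneg hc]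

lemma LipschitzWith.comp_memLp_of_isFiniteMeasure [IsFiniteMeasure P] {F : Type*}
    [NormedAddCommGroup F] {K : ℝ≥0} {g : H → F} (hg : LipschitzWith K g) {A : Ω → H}
    (hA : MemLp A 2 P) : MemLp (fun ω => g (A ω)) 2 P := by
  have h1 : LipschitzWith K (fun x => g x - g 0) := by
    simpa using hg.sub (LipschitzWith.const (g 0))
  have h2 := (h1.comp_memLp (by simp) hA).add (memLp_const (g 0))
  refine h2.ae_eq (Eventually.of_forall fun ω => ?_)
  simp

end LpNormTwo

lemma le_geometric_of_le_mul_add {v : ℕ → ℝ} {ρ c : ℝ} (hρ0 : 0 ≤ ρ) (hρ1 : ρ < 1)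
    (h : ∀ k, v (k + 1) ≤ ρ * v k + c) (k : ℕ) :
    v k ≤ ρ ^ k * v 0 + (1 - ρ ^ k) / (1 - ρ) * c := by
  induction k with
  | zero => simp
  | succ k ih =>
    have hρ : 1 - ρ ≠ 0 := by linarith
    calc v (k + 1) ≤ ρ * v k + c := h k
      _ ≤ ρ * (ρ ^ k * v 0 + (1 - ρ ^ k) / (1 - ρ) * c) + c := by gcongr
      _ = _ := by
        field_simp
        ring

section SecondMoments

variable {Ω : Type*} {mΩ : MeasurableSpace Ω} {P : Measure Ω}
  {H : Type*} [NormedAddCommGroup H] [InnerProductSpace ℝ H]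

lemma MeasureTheory.MemLp.integrable_inner_of_two_s2 {A B : Ω → H} (hA : MemLp A 2 P)
    (hB : MemLp B 2 P) : Integrable (fun ω => ⟪A ω, B ω⟫) P := by
  refine Integrable.mono' (hA.norm.integrable_mul hB.norm)
    (hA.aestronglyMeasurable.inner hB.aestronglyMeasurable) (Eventually.of_forall fun ω => ?_)
  exact norm_inner_le_norm _ _

lemma integral_inner_eq_zero_of_condExp_eq_zero [CompleteSpace H] {m : MeasurableSpace Ω}
    (hm : m ≤ mΩ) [IsFiniteMeasure P] {Z ξ : Ω → H} (hZ : StronglyMeasurable[m] Z)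
    (hZ2 : MemLp Z 2 P) (hξ : MemLp ξ 2 P) (h0 : P[ξ|m] =ᵐ[P] 0) :
    ∫ ω, ⟪Z ω, ξ ω⟫ ∂P = 0 := by
  have h := condExp_bilin_of_stronglyMeasurable_left (innerSL ℝ (E := H)) hZ
    (hZ2.integrable_inner_of_two_s2 hξ) (hξ.integrable one_le_two)
  have h1 : P[fun ω => ⟪Z ω, ξ ω⟫|m] =ᵐ[P] 0 := by
    refine h.trans ?_
    filter_upwards [h0] with ω hω
    simp [hω]
  rw [← integral_condExp hm, integral_congr_ae h1]
  simp

lemma integral_norm_sub_smul_sq {A ξ : Ω → H} (hA : MemLp A 2 P) (hξ : MemLp ξ 2 P)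
    (h : ∫ ω, ⟪A ω, ξ ω⟫ ∂P = 0) (α : ℝ) :
    ∫ ω, ‖A ω - α • ξ ω‖ ^ 2 ∂P = ∫ ω, ‖A ω‖ ^ 2 ∂P + α ^ 2 * ∫ ω, ‖ξ ω‖ ^ 2 ∂P := by
  have hA2 := hA.integrable_norm_pow (by norm_num : (2 : ℕ) ≠ 0)
  have hξ2 := hξ.integrable_norm_pow (by norm_num : (2 : ℕ) ≠ 0)
  have hAξ := hA.integrable_inner_of_two_s2 hξ
  have : ∀ ω, ‖A ω - α • ξ ω‖ ^ 2 =
      ‖A ω‖ ^ 2 - 2 * α * ⟪A ω, ξ ω⟫ + α ^ 2 * ‖ξ ω‖ ^ 2 := fun ω => by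
    rw [norm_sub_sq_real, inner_smul_right, norm_smul, mul_pow, Real.norm_eq_abs, sq_abs]
    ring
  simp_rw [this]
  have hsub : Integrable (fun ω => ‖A ω‖ ^ 2 - 2 * α * ⟪A ω, ξ ω⟫) P :=
    hA2.sub (hAξ.const_mul _)
  rw [integral_add hsub (hξ2.const_mul _), integral_sub hA2 (hAξ.const_mul _),
    integral_const_mul, integral_const_mul, h]
  ring

/-- Second moments along a contraction perturbed by orthogonal noise. -/
lemma integral_norm_sq_le_of_contraction {Z T ξ : ℕ → Ω → H} {α ρ v : ℝ}
    (hρ0 : 0 ≤ ρ) (hρ1 : ρ < 1) (hZ : ∀ k, MemLp (Z k) 2 P) (hT : ∀ k, MemLp (T k) 2 P)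
    (hξ : ∀ k, MemLp (ξ k) 2 P)
    (horth : ∀ k, ∫ ω, ⟪T k ω, ξ k ω⟫ ∂P = 0) (hv : ∀ k, ∫ ω, ‖ξ k ω‖ ^ 2 ∂P ≤ v)
    (hrec : ∀ k ω, Z (k + 1) ω = T k ω - α • ξ k ω)
    (hcontr : ∀ k ω, ‖T k ω‖ ^ 2 ≤ ρ * ‖Z k ω‖ ^ 2) (k : ℕ) :
    ∫ ω, ‖Z k ω‖ ^ 2 ∂P ≤
      ρ ^ k * ∫ ω, ‖Z 0 ω‖ ^ 2 ∂P + (1 - ρ ^ k) / (1 - ρ) * (α ^ 2 * v) := by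
  refine le_geometric_of_le_mul_add (v := fun k => ∫ ω, ‖Z k ω‖ ^ 2 ∂P) hρ0 hρ1 (fun k => ?_) k
  simp only [hrec]
  rw [integral_norm_sub_smul_sq (hT k) (hξ k) (horth k)]
  have h1 : ∫ ω, ‖T k ω‖ ^ 2 ∂P ≤ ∫ ω, ρ * ‖Z k ω‖ ^ 2 ∂P :=
    integral_mono ((hT k).integrable_norm_pow two_ne_zero)
      (((hZ k).integrable_norm_pow two_ne_zero).const_mul ρ) (hcontr k)
  rw [integral_const_mul] at h1
  have h2 := mul_le_mul_of_nonneg_left (hv k) (sq_nonneg α)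
  linarith

end SecondMoments

section BlockNoise

variable {Ω : Type*} {mΩ : MeasurableSpace Ω} {P : Measure Ω}
  {N : ℕ} {E : Type*} [NormedAddCommGroup E] [InnerProductSpace ℝ E]
  {m : MeasurableSpace Ω} {w : Ω → PiLp 2 (fun _ : Fin N => E)}

lemma memLp_block (hw : MemLp w 2 P) (i : Fin N) : MemLp (fun ω => w ω i) 2 P :=
  (PiLp.proj (𝕜 := ℝ) 2 (fun _ : Fin N => E) i).comp_memLp' hw

lemma integral_inner_blocks_eq_zero [CompleteSpace E]
    [IsProbabilityMeasure P] (hm : m ≤ mΩ) (hw : MemLp w 2 P)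
    (hmean : ∀ i, P[fun ω => w ω i|m] =ᵐ[P] 0) {Z : Ω → PiLp 2 (fun _ : Fin N => E)}
    (hZ : StronglyMeasurable[m] Z) (hZ2 : MemLp Z 2 P) : ∫ ω, ⟪Z ω, w ω⟫ ∂P = 0 := by
  simp only [PiLp.inner_apply]
  rw [integral_finsetSum]
  · refine Finset.sum_eq_zero fun i _ => ?_
    refine integral_inner_eq_zero_of_condExp_eq_zero hm ?_ (memLp_block hZ2 i)
      (memLp_block hw i) (hmean i)
    exact (PiLp.proj (𝕜 := ℝ) 2 (fun _ : Fin N => E) i).continuous.comp_stronglyMeasurable hZ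
  · exact fun i _ => (memLp_block hZ2 i).integrable_inner_of_two_s2 (memLp_block hw i)

lemma integral_inner_blockMean_eq_zero [CompleteSpace E]
    [IsProbabilityMeasure P] (hm : m ≤ mΩ) (hw : MemLp w 2 P)
    (hmean : ∀ i, P[fun ω => w ω i|m] =ᵐ[P] 0) {Z : Ω → E}
    (hZ : StronglyMeasurable[m] Z) (hZ2 : MemLp Z 2 P) :
    ∫ ω, ⟪Z ω, blockMean (w ω)⟫ ∂P = 0 := by
  simp only [blockMean_apply, inner_smul_right, inner_sum]
  rw [integral_const_mul, integral_finsetSum]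
  · rw [Finset.sum_eq_zero, mul_zero]
    exact fun i _ => integral_inner_eq_zero_of_condExp_eq_zero hm hZ hZ2
      (memLp_block hw i) (hmean i)
  · exact fun i _ => hZ2.integrable_inner_of_two_s2 (memLp_block hw i)

lemma integral_le_of_condExp_le [IsProbabilityMeasure P] {φ : Ω → ℝ} {c : ℝ} (hm : m ≤ mΩ)
    (h : ∀ᵐ ω ∂P, (P[φ|m]) ω ≤ c) : ∫ ω, φ ω ∂P ≤ c := by
  rw [← integral_condExp hm]
  refine (integral_mono_ae integrable_condExp (integrable_const _) h).trans_eq ?_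
  simp

lemma integral_norm_blocks_sq_le [IsProbabilityMeasure P] {σ : ℝ} (hm : m ≤ mΩ)
    (hw : MemLp w 2 P)
    (hvar : ∀ i, ∀ᵐ ω ∂P, (P[fun ω' => ‖w ω' i‖ ^ 2|m]) ω ≤ σ ^ 2) :
    ∫ ω, ‖w ω‖ ^ 2 ∂P ≤ N * σ ^ 2 := by
  simp only [PiLp.norm_sq_eq_of_L2]
  rw [integral_finsetSum]
  · refine (Finset.sum_le_sum fun i _ => integral_le_of_condExp_le hm (hvar i)).trans_eq ?_
    simp
  · exact fun i _ => (memLp_block hw i).integrable_norm_pow two_ne_zero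

lemma integral_norm_blockMean_sq_le [IsProbabilityMeasure P] {σ : ℝ} (hm : m ≤ mΩ)
    (hw : MemLp w 2 P)
    (hvar : ∀ i, ∀ᵐ ω ∂P, (P[fun ω' => ‖w ω' i‖ ^ 2|m]) ω ≤ σ ^ 2)
    (hcross : ∀ i j, i ≠ j → P[fun ω => ⟪w ω i, w ω j⟫|m] =ᵐ[P] 0) :
    ∫ ω, ‖blockMean (w ω)‖ ^ 2 ∂P ≤ σ ^ 2 / N := by
  have hpair : ∀ i j, Integrable (fun ω => ⟪w ω i, w ω j⟫) P := fun i j =>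
    (memLp_block hw i).integrable_inner_of_two_s2 (memLp_block hw j)
  have hoff : ∀ i j, i ≠ j → ∫ ω, ⟪w ω i, w ω j⟫ ∂P = 0 := fun i j hij => by
    rw [← integral_condExp hm, integral_congr_ae (hcross i j hij)]
    simp
  have hexp : ∀ ω, ‖blockMean (w ω)‖ ^ 2 = (1 / (N : ℝ)) ^ 2 * ∑ i, ∑ j, ⟪w ω i, w ω j⟫ := by
    intro ω
    rw [blockMean_apply, norm_smul, mul_pow, Real.norm_eq_abs, sq_abs,
      ← real_inner_self_eq_norm_sq, sum_inner]
    simp only [inner_sum]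
  simp only [hexp]
  rw [integral_const_mul, integral_finsetSum _ fun i _ =>
    integrable_finsetSum _ fun j _ => hpair i j]
  have hdiag : ∀ i, ∫ ω, ∑ j, ⟪w ω i, w ω j⟫ ∂P ≤ σ ^ 2 := by
    intro i
    rw [integral_finsetSum _ fun j _ => hpair i j, Finset.sum_eq_single i
      (fun j _ hj => hoff i j hj.symm) (by simp)]
    simp only [real_inner_self_eq_norm_sq]
    exact integral_le_of_condExp_le hm (hvar i)
  calc (1 / (N : ℝ)) ^ 2 * ∑ i, ∫ ω, ∑ j, ⟪w ω i, w ω j⟫ ∂P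
      ≤ (1 / (N : ℝ)) ^ 2 * ∑ _i : Fin N, σ ^ 2 := by
        gcongr with i
        exact hdiag i
    _ = σ ^ 2 / N := by
        rcases N.eq_zero_or_pos with rfl | hN
        · simp
        · simp
          field_simp

end BlockNoise

section BlockGradient

/-- The vector with all blocks equal. -/
noncomputable def blockConst {N : ℕ} {E : Type*} (u : E) : PiLp 2 (fun _ : Fin N => E) :=
  WithLp.toLp 2 fun _ => u

@[simp]
lemma blockConst_apply {N : ℕ} {E : Type*} (u : E) (i : Fin N) :
    (blockConst u : PiLp 2 (fun _ : Fin N => E)) i = u :=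
  rfl

/-- The blockwise gradient. -/
noncomputable def blockGrad {N : ℕ} {E : Type*} (g : Fin N → E → E)
    (x : PiLp 2 (fun _ : Fin N => E)) :
    PiLp 2 (fun _ : Fin N => E) := WithLp.toLp 2 fun i => g i (x i)

@[simp]
lemma blockGrad_apply {N : ℕ} {E : Type*} (g : Fin N → E → E)
    (x : PiLp 2 (fun _ : Fin N => E)) (i : Fin N) :
    blockGrad g x i = g i (x i) := rfl

lemma norm_blockConst_sub_sq {N : ℕ} {E : Type*} [NormedAddCommGroup E] (u v : E) :
    ‖(blockConst u : PiLp 2 (fun _ : Fin N => E)) - blockConst v‖ ^ 2 = N * ‖u - v‖ ^ 2 := by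
  simp [PiLp.norm_sq_eq_of_L2]

variable {N : ℕ} {E : Type*} [NormedAddCommGroup E] [InnerProductSpace ℝ E]

lemma blockMean_blockConst (hN : 0 < N) (u : E) :
    blockMean (blockConst u : PiLp 2 (fun _ : Fin N => E)) = u := by
  rw [blockMean_apply]
  simp only [blockConst_apply, Finset.sum_const, Finset.card_univ, Fintype.card_fin]
  rw [← Nat.cast_smul_eq_nsmul ℝ, smul_smul, one_div_mul_cancel (by positivity), one_smul]

lemma blockDev_eq_sub_blockConst (x : PiLp 2 (fun _ : Fin N => E)) :
    blockDev x = x - blockConst (blockMean x) := by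
  ext i : 1
  simp

/-- The average of the gradients at a common point. -/
noncomputable def meanGrad (g : Fin N → E → E) (u : E) : E := blockMean (blockGrad g (blockConst u))

variable {g : Fin N → E → E} {μ L : ℝ}

lemma blockGrad_interpolation
    (h : ∀ i x y, ‖g i x - g i y‖ ^ 2 + μ * L * ‖x - y‖ ^ 2 ≤ (L + μ) * ⟪g i x - g i y, x - y⟫)
    (x y : PiLp 2 (fun _ : Fin N => E)) :
    ‖blockGrad g x - blockGrad g y‖ ^ 2 + μ * L * ‖x - y‖ ^ 2 ≤
      (L + μ) * ⟪blockGrad g x - blockGrad g y, x - y⟫ := by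
  rw [PiLp.norm_sq_eq_of_L2, PiLp.norm_sq_eq_of_L2, PiLp.inner_apply, Finset.mul_sum,
    Finset.mul_sum, ← Finset.sum_add_distrib]
  exact Finset.sum_le_sum fun i _ => h i (x i) (y i)

lemma meanGrad_interpolation (hN : 0 < N)
    (h : ∀ i x y, ‖g i x - g i y‖ ^ 2 + μ * L * ‖x - y‖ ^ 2 ≤ (L + μ) * ⟪g i x - g i y, x - y⟫)
    (u v : E) :
    ‖meanGrad g u - meanGrad g v‖ ^ 2 + μ * L * ‖u - v‖ ^ 2 ≤
      (L + μ) * ⟪meanGrad g u - meanGrad g v, u - v⟫ := by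
  have h1 := blockGrad_interpolation h (blockConst u) (blockConst v)
  have h2 := card_mul_norm_blockMean_sq_le
    (blockGrad g (blockConst u) - blockGrad g (blockConst v))
  have h3 : ⟪blockGrad g (blockConst u) - blockGrad g (blockConst v),
      blockConst u - blockConst v⟫ = N * ⟪meanGrad g u - meanGrad g v, u - v⟫ := by
    rw [meanGrad, meanGrad, ← map_sub, ← real_inner_smul_left, ← sum_blocks, sum_inner,
      PiLp.inner_apply]
    simp
  rw [norm_blockConst_sub_sq, h3] at h1
  rw [map_sub] at h2
  have hN' : (0 : ℝ) < N := by positivity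
  refine le_of_mul_le_mul_left ?_ hN'
  simp only [meanGrad] at h1 ⊢
  linarith

lemma norm_blockMean_blockGrad_sub_meanGrad_le (hN : 0 < N) (hL : 0 ≤ L)
    (hlip : ∀ x y, ‖blockGrad g x - blockGrad g y‖ ≤ L * ‖x - y‖)
    (x : PiLp 2 (fun _ : Fin N => E)) :
    ‖blockMean (blockGrad g x) - meanGrad g (blockMean x)‖ ≤ L / √N * ‖blockDev x‖ := by
  have hN' : (0 : ℝ) < N := by positivity
  have h1 := card_mul_norm_blockMean_sq_le
    (blockGrad g x - blockGrad g (blockConst (blockMean x)))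
  have h2 := hlip x (blockConst (blockMean x))
  rw [← blockDev_eq_sub_blockConst] at h2
  rw [map_sub] at h1
  refine le_of_sq_le_sq ?_ (by positivity)
  rw [mul_pow, div_pow, Real.sq_sqrt hN'.le, div_mul_eq_mul_div, le_div_iff₀ hN', mul_comm]
  refine h1.trans ?_
  rw [← mul_pow]
  gcongr

lemma lipschitzWith_of_norm_sub_le {F F' : Type*} [SeminormedAddCommGroup F]
    [SeminormedAddCommGroup F'] {φ : F → F'} {L : ℝ}
    (h : ∀ x y, ‖φ x - φ y‖ ≤ L * ‖x - y‖) : LipschitzWith (Real.toNNReal L) φ :=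
  LipschitzWith.of_dist_le' fun x y => by simpa [dist_eq_norm] using h x y

lemma meanGrad_eq_zero_of_minimizer [CompleteSpace E] {f : Fin N → E → ℝ}
    (hg : ∀ i x, HasGradientAt (f i) (g i x) x) {u : E}
    (hu : ∀ y, (1 / (N : ℝ)) * ∑ i, f i u ≤ (1 / (N : ℝ)) * ∑ i, f i y) : meanGrad g u = 0 := by
  have hd : HasFDerivAt (fun y => (1 / (N : ℝ)) * ∑ i, f i y)
      ((1 / (N : ℝ)) • ∑ i, InnerProductSpace.toDual ℝ E (g i u)) u :=
    (HasFDerivAt.fun_sum fun i _ => (hg i u).hasFDerivAt).const_mul _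
  have h0 := IsLocalMin.hasFDerivAt_eq_zero (Eventually.of_forall hu) hd
  rw [← map_sum, ← map_smul] at h0
  rw [meanGrad, blockMean_apply]
  exact (InnerProductSpace.toDual ℝ E).map_eq_zero_iff.1 h0

end BlockGradient

lemma sq_le_network_effect {n μ L α σ γ D a c ε : ℝ} (hn : 0 < n) (hμ : 0 < μ) (hμL : μ ≤ L)
    (hα : 0 < α) (hαL : α * L < 2) (hγ0 : 0 ≤ γ) (hγ1 : γ < 1) (ha : 0 ≤ a) (haD : 2 * L * a ≤ D)
    (hc2 : c ^ 2 = α ^ 2 * (n * σ ^ 2) / (1 - γ ^ 2)) (hε0 : 0 ≤ ε)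
    (hε : ε ≤ L / √n * (α * a / (1 - γ) + (α * D / (1 - γ) + c) / μ)) :
    ε ^ 2 ≤ 4 * (α / (μ * (1 - α * L / 2)) + (1 + α * L) ^ 2 / (μ ^ 2 * (1 - α * L / 2) ^ 2)) *
      (L ^ 2 * D ^ 2 * α ^ 2 / (n * (1 - γ) ^ 2) + L ^ 2 * σ ^ 2 * α ^ 2 / (1 - γ ^ 2)) := by
  have hL : 0 < L := hμ.trans_le hμL
  have hg : 0 < 1 - γ := by linarith
  have hg2 : 0 < 1 - γ ^ 2 := by nlinarith
  have hh : 0 < 1 - α * L / 2 := by linarith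
  have hh1 : 1 - α * L / 2 ≤ 1 := by nlinarith [mul_pos hα hL]
  set b := α * D / (1 - γ) with hb
  have hD : 0 ≤ D := le_trans (by positivity) haD
  have hb0 : 0 ≤ b := by positivity
  have h1 : α * a / (1 - γ) ≤ b / 2 / μ := by
    rw [hb, div_div, div_div, div_le_div_iff₀ hg (by positivity)]
    have h2 : 2 * μ * a ≤ D := le_trans (by gcongr) haD
    have h3 : α * (1 - γ) * (2 * μ * a) ≤ α * (1 - γ) * D := by gcongr
    linarith
  have h2 : ε ≤ L / √n * ((3 / 2 * b + c) / μ) := by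
    refine hε.trans ?_
    gcongr
    have : (3 / 2 * b + c) / μ = b / 2 / μ + (b + c) / μ := by ring
    linarith
  have h3 : ε ^ 2 ≤ (L / √n * ((3 / 2 * b + c) / μ)) ^ 2 := by gcongr
  have h4 : (3 / 2 * b + c) ^ 2 ≤ 4 * (b ^ 2 + c ^ 2) := by
    nlinarith [sq_nonneg (b - 3 / 2 * c), sq_nonneg c, sq_nonneg b]
  have h5 : 1 / μ ^ 2 ≤
      α / (μ * (1 - α * L / 2)) + (1 + α * L) ^ 2 / (μ ^ 2 * (1 - α * L / 2) ^ 2) := by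
    have h6 : 1 / μ ^ 2 ≤ (1 + α * L) ^ 2 / (μ ^ 2 * (1 - α * L / 2) ^ 2) := by
      have h7 : (1 - α * L / 2) ^ 2 ≤ 1 := pow_le_one₀ hh.le hh1
      have h8 : 1 ≤ (1 + α * L) ^ 2 := one_le_pow₀ (by nlinarith [mul_pos hα hL])
      apply div_le_div₀ (by positivity) h8 (by positivity)
      exact mul_le_of_le_one_right (by positivity) h7
    have h9 : 0 ≤ α / (μ * (1 - α * L / 2)) := by positivity
    linarith
  have h6 : L ^ 2 * D ^ 2 * α ^ 2 / (n * (1 - γ) ^ 2) + L ^ 2 * σ ^ 2 * α ^ 2 / (1 - γ ^ 2) =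
      L ^ 2 / n * (b ^ 2 + c ^ 2) := by
    rw [hc2, hb]
    field_simp
  calc ε ^ 2 ≤ (L / √n * ((3 / 2 * b + c) / μ)) ^ 2 := h3
    _ = 1 / μ ^ 2 * (L ^ 2 / n * (3 / 2 * b + c) ^ 2) := by
        rw [mul_pow, div_pow, div_pow, Real.sq_sqrt hn.le]
        ring
    _ ≤ 1 / μ ^ 2 * (L ^ 2 / n * (4 * (b ^ 2 + c ^ 2))) := by gcongr
    _ ≤ (α / (μ * (1 - α * L / 2)) + (1 + α * L) ^ 2 / (μ ^ 2 * (1 - α * L / 2) ^ 2)) *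
        (L ^ 2 / n * (4 * (b ^ 2 + c ^ 2))) := by gcongr
    _ = _ := by
        rw [h6]
        ring

lemma div_pow_sub_pow_nonneg {x y : ℝ} (hx : 0 ≤ x) (hy : 0 ≤ y) (k : ℕ) :
    0 ≤ (x ^ k - y ^ k) / (x - y) := by
  rcases le_total x y with h | h
  · exact div_nonneg_of_nonpos (sub_nonpos.2 (pow_le_pow_left₀ hx h k)) (sub_nonpos.2 h)
  · exact div_nonneg (sub_nonneg.2 (pow_le_pow_left₀ hy h k)) (sub_nonneg.2 h)

lemma geometric_mul_le {ρ c : ℝ} (hρ0 : 0 ≤ ρ) (hρ1 : ρ < 1) (hc : 0 ≤ c) (k : ℕ) :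
    (1 - ρ ^ k) / (1 - ρ) * c ≤ c / (1 - ρ) := by
  have h1 : 0 < 1 - ρ := by linarith
  have h2 : 0 ≤ ρ ^ k * (c / (1 - ρ)) := by positivity
  have h3 : (1 - ρ ^ k) / (1 - ρ) * c = c / (1 - ρ) - ρ ^ k * (c / (1 - ρ)) := by ring
  linarith

section StochasticIteration

variable {Ω : Type*} {mΩ : MeasurableSpace Ω} {P : Measure Ω}
  {H : Type*} [NormedAddCommGroup H] [InnerProductSpace ℝ H]

/-- The iteration `z (k + 1) = Φ (z k) - α ξ k` started at a deterministic point. -/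
noncomputable def stochIter (Φ : H → H) (α : ℝ) (ξ : ℕ → Ω → H) (z₀ : H) : ℕ → Ω → H
  | 0 => fun _ => z₀
  | k + 1 => fun ω => Φ (stochIter Φ α ξ z₀ k ω) - α • ξ k ω

variable {Φ : H → H} {α : ℝ} {ξ Z : ℕ → Ω → H} {z₀ : H} {K : ℝ≥0}

lemma memLp_of_recursion [IsFiniteMeasure P] (hΦ : LipschitzWith K Φ) (h0 : ∀ ω, Z 0 ω = z₀)
    (hrec : ∀ k ω, Z (k + 1) ω = Φ (Z k ω) - α • ξ k ω) (hξ : ∀ k, MemLp (ξ k) 2 P) (k : ℕ) :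
    MemLp (Z k) 2 P := by
  induction k with
  | zero =>
    rw [funext h0]
    exact memLp_const z₀
  | succ k ih =>
    rw [funext (hrec k)]
    exact (hΦ.comp_memLp_of_isFiniteMeasure ih).sub ((hξ k).const_smul α)

lemma stronglyMeasurable_of_recursion {ℱ : ℕ → MeasurableSpace Ω} (hℱ : Monotone ℱ)
    (hΦ : Continuous Φ) (h0 : ∀ ω, Z 0 ω = z₀)
    (hrec : ∀ k ω, Z (k + 1) ω = Φ (Z k ω) - α • ξ k ω)
    (hξ : ∀ k, StronglyMeasurable[ℱ (k + 1)] (ξ k)) (k : ℕ) :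
    StronglyMeasurable[ℱ k] (Z k) := by
  induction k with
  | zero =>
    rw [funext h0]
    exact stronglyMeasurable_const
  | succ k ih =>
    rw [funext (hrec k)]
    exact (hΦ.comp_stronglyMeasurable (ih.mono (hℱ k.le_succ))).sub ((hξ k).const_smul α)

/-- Mean square distance to `z'` along a stochastic iteration contracting towards `z'`. -/
lemma integral_norm_sub_sq_le_of_recursion [IsProbabilityMeasure P] {ℱ : ℕ → MeasurableSpace Ω}
    {ρ v : ℝ} {z' : H} (hℱ : Monotone ℱ) (hΦ : LipschitzWith K Φ) (h0 : ∀ ω, Z 0 ω = z₀)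
    (hrec : ∀ k ω, Z (k + 1) ω = Φ (Z k ω) - α • ξ k ω) (hξ2 : ∀ k, MemLp (ξ k) 2 P)
    (hξm : ∀ k, StronglyMeasurable[ℱ (k + 1)] (ξ k))
    (horth : ∀ k (Y : Ω → H), StronglyMeasurable[ℱ k] Y → MemLp Y 2 P →
      ∫ ω, ⟪Y ω, ξ k ω⟫ ∂P = 0)
    (hv : ∀ k, ∫ ω, ‖ξ k ω‖ ^ 2 ∂P ≤ v) (hρ0 : 0 ≤ ρ) (hρ1 : ρ < 1)
    (hcontr : ∀ z, ‖Φ z - z'‖ ^ 2 ≤ ρ * ‖z - z'‖ ^ 2) (k : ℕ) :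
    ∫ ω, ‖Z k ω - z'‖ ^ 2 ∂P ≤
      ρ ^ k * ‖z₀ - z'‖ ^ 2 + (1 - ρ ^ k) / (1 - ρ) * (α ^ 2 * v) := by
  have hZ := memLp_of_recursion hΦ h0 hrec hξ2
  have hT : ∀ k, MemLp (fun ω => Φ (Z k ω) - z') 2 P := fun k =>
    (hΦ.comp_memLp_of_isFiniteMeasure (hZ k)).sub (memLp_const z')
  refine (integral_norm_sq_le_of_contraction (α := α) (Z := fun k ω => Z k ω - z') hρ0 hρ1
    (fun k => (hZ k).sub (memLp_const z')) hT hξ2 (fun k => horth k _ ?_ (hT k)) hv ?_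
    (fun k ω => hcontr _) k).trans_eq ?_
  · exact (hΦ.continuous.comp_stronglyMeasurable
      (stronglyMeasurable_of_recursion hℱ hΦ.continuous h0 hrec hξm k)).sub
      stronglyMeasurable_const
  · intro k ω
    simp only [hrec]
    abel
  · simp [h0]

lemma lpNorm_le_of_recursion [IsProbabilityMeasure P] {ℱ : ℕ → MeasurableSpace Ω} {γ v : ℝ}
    {Φ : H →L[ℝ] H} (hℱ : Monotone ℱ) (hγ0 : 0 ≤ γ) (hγ1 : γ < 1)
    (hcontr : ∀ z, ‖Φ z‖ ≤ γ * ‖z‖) (h0 : ∀ ω, Z 0 ω = 0)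
    (hrec : ∀ k ω, Z (k + 1) ω = Φ (Z k ω) - α • ξ k ω) (hξ2 : ∀ k, MemLp (ξ k) 2 P)
    (hξm : ∀ k, StronglyMeasurable[ℱ (k + 1)] (ξ k))
    (horth : ∀ k (Y : Ω → H), StronglyMeasurable[ℱ k] Y → MemLp Y 2 P →
      ∫ ω, ⟪Y ω, ξ k ω⟫ ∂P = 0)
    (hv : ∀ k, ∫ ω, ‖ξ k ω‖ ^ 2 ∂P ≤ v) (k : ℕ) :
    lpNorm (Z k) 2 P ≤ √(α ^ 2 * v / (1 - γ ^ 2)) := by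
  have hγ2 : γ ^ 2 < 1 := by nlinarith
  have hv0 : 0 ≤ v := (integral_nonneg fun ω => by positivity).trans (hv 0)
  have h := integral_norm_sub_sq_le_of_recursion (z' := 0) (ρ := γ ^ 2) hℱ Φ.lipschitz h0 hrec
    hξ2 hξm horth hv (by positivity) hγ2 (fun z => by
      rw [sub_zero, sub_zero, ← mul_pow]
      gcongr
      exact hcontr z) k
  simp only [sub_zero, norm_zero] at h
  refine Real.le_sqrt_of_sq_le ?_
  rw [lpNorm_two_sq (memLp_of_recursion Φ.lipschitz h0 hrec hξ2 k)]
  have h1 := geometric_mul_le (sq_nonneg γ) hγ2 (mul_nonneg (sq_nonneg α) hv0) k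
  linarith

end StochasticIteration

section Consensus

variable {Ω : Type*} {mΩ : MeasurableSpace Ω} {P : Measure Ω}
  {N : ℕ} {E : Type*} [NormedAddCommGroup E] [InnerProductSpace ℝ E]

lemma blockMean_blockDev (z : PiLp 2 (fun _ : Fin N => E)) : blockMean (blockDev z) = 0 := by
  rw [blockMean_apply, sum_blockDev, smul_zero]

lemma blockDev_blockDev (z : PiLp 2 (fun _ : Fin N => E)) : blockDev (blockDev z) = blockDev z := by
  ext i : 1
  simp [blockMean_blockDev]

lemma inner_blockDev_right (x y : PiLp 2 (fun _ : Fin N => E)) :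
    ⟪x, blockDev y⟫ = ⟪blockDev x, y⟫ := by
  have h1 : ⟪x, blockDev y⟫ = ∑ i, ⟪x i, y i⟫ - N * ⟪blockMean x, blockMean y⟫ := by
    rw [← real_inner_smul_left, ← sum_blocks, sum_inner, PiLp.inner_apply,
      ← Finset.sum_sub_distrib]
    simp [inner_sub_right]
  have h2 : ⟪blockDev x, y⟫ = ∑ i, ⟪x i, y i⟫ - N * ⟪blockMean x, blockMean y⟫ := by
    rw [← real_inner_smul_right, ← sum_blocks, inner_sum, PiLp.inner_apply,
      ← Finset.sum_sub_distrib]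
    simp [inner_sub_left]
  rw [h1, h2]

variable {W : Matrix (Fin N) (Fin N) ℝ} {α γ D v : ℝ} {ℱ : ℕ → MeasurableSpace Ω}
  {X G ξ : ℕ → Ω → PiLp 2 (fun _ : Fin N => E)} {x₀ : PiLp 2 (fun _ : Fin N => E)}

lemma memLp_blockDev {A : Ω → PiLp 2 (fun _ : Fin N => E)} (hA : MemLp A 2 P) :
    MemLp (fun ω => blockDev (A ω)) 2 P :=
  (blockDev (N := N) (E := E)).comp_memLp' hA

/-- The consensus error of a noisy decentralized iteration with bounded gradients. -/
lemma lpNorm_blockDev_le [IsProbabilityMeasure P] (hα : 0 ≤ α) (hγ0 : 0 ≤ γ) (hγ1 : γ < 1)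
    (hD : 0 ≤ D) (hrow : ∀ i, ∑ j, W i j = 1) (hcol : ∀ j, ∑ i, W i j = 1)
    (hW : ∀ z : PiLp 2 (fun _ : Fin N => E), ∑ i, z i = 0 → ‖mixing W z‖ ≤ γ * ‖z‖)
    (hℱ : Monotone ℱ) (h0 : ∀ ω, X 0 ω = x₀)
    (hrec : ∀ k ω, X (k + 1) ω = mixing W (X k ω) - α • G k ω - α • ξ k ω)
    (hX : ∀ k, MemLp (X k) 2 P) (hG : ∀ k, MemLp (G k) 2 P) (hGD : ∀ k, lpNorm (G k) 2 P ≤ D)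
    (hξ2 : ∀ k, MemLp (ξ k) 2 P) (hξm : ∀ k, StronglyMeasurable[ℱ (k + 1)] (ξ k))
    (horth : ∀ k (Y : Ω → PiLp 2 (fun _ : Fin N => E)), StronglyMeasurable[ℱ k] Y → MemLp Y 2 P →
      ∫ ω, ⟪Y ω, ξ k ω⟫ ∂P = 0)
    (hv : ∀ k, ∫ ω, ‖ξ k ω‖ ^ 2 ∂P ≤ v) (k : ℕ) :
    lpNorm (fun ω => blockDev (X k ω)) 2 P ≤
      γ ^ k * ‖blockDev x₀‖ + (α * D / (1 - γ) + √(α ^ 2 * v / (1 - γ ^ 2))) := by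
  obtain ⟨Φ, hΦ⟩ : ∃ Φ : PiLp 2 (fun _ : Fin N => E) →L[ℝ] PiLp 2 (fun _ : Fin N => E),
      ∀ z, Φ z = mixing W (blockDev z) := ⟨mixing W ∘L blockDev, fun _ => rfl⟩
  have hcontr : ∀ z, ‖Φ z‖ ≤ γ * ‖z‖ := fun z => by
    rw [hΦ]
    exact (hW _ (sum_blockDev z)).trans (by gcongr; exact norm_blockDev_le z)
  obtain ⟨S, hS0, hSrec⟩ : ∃ S : ℕ → Ω → PiLp 2 (fun _ : Fin N => E), (∀ ω, S 0 ω = 0) ∧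
      ∀ k ω, S (k + 1) ω = Φ (S k ω) - α • blockDev (ξ k ω) :=
    ⟨stochIter Φ α (fun k ω => blockDev (ξ k ω)) 0, fun _ => rfl, fun _ _ => rfl⟩
  have hη2 : ∀ k, MemLp (fun ω => blockDev (ξ k ω)) 2 P := fun k => memLp_blockDev (hξ2 k)
  have hSL : ∀ k, MemLp (S k) 2 P := memLp_of_recursion Φ.lipschitz hS0 hSrec hη2
  have hSc := lpNorm_le_of_recursion (v := v) hℱ hγ0 hγ1 hcontr hS0 hSrec hη2
    (fun k => blockDev.continuous.comp_stronglyMeasurable (hξm k))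
    (fun k Y hY hY2 => by
      simp only [inner_blockDev_right]
      exact horth k _ (blockDev.continuous.comp_stronglyMeasurable hY) (memLp_blockDev hY2))
    (fun k => (integral_mono ((hη2 k).integrable_norm_pow two_ne_zero)
      ((hξ2 k).integrable_norm_pow two_ne_zero)
      fun ω => pow_le_pow_left₀ (norm_nonneg _) (norm_blockDev_le _) 2).trans (hv k))
  have hH : ∀ k, MemLp (fun ω => blockDev (X k ω) - S k ω) 2 P := fun k =>
    (memLp_blockDev (hX k)).sub (hSL k)
  have hstep : ∀ k, lpNorm (fun ω => blockDev (X (k + 1) ω) - S (k + 1) ω) 2 P ≤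
      γ * lpNorm (fun ω => blockDev (X k ω) - S k ω) 2 P + α * D := by
    intro k
    refine (lpNorm_two_le_add (hH (k + 1)) (hH k) (hG k) hγ0 hα fun ω => ?_).trans
      (by gcongr; exact hGD k)
    have h1 : blockDev (X (k + 1) ω) - S (k + 1) ω =
        Φ (blockDev (X k ω) - S k ω) - α • blockDev (G k ω) := by
      rw [hSrec, hrec, map_sub, map_sub, map_smul, map_smul, map_sub, hΦ (blockDev _),
        blockDev_blockDev, blockDev_mixing hrow hcol]
      abel
    rw [h1]
    refine (norm_sub_le _ _).trans (add_le_add (hcontr _) ?_)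
    rw [norm_smul, Real.norm_eq_abs, abs_of_nonneg hα]
    gcongr
    exact norm_blockDev_le _
  have hHk := le_geometric_of_le_mul_add
    (v := fun k => lpNorm (fun ω => blockDev (X k ω) - S k ω) 2 P) hγ0 hγ1 hstep k
  have hH0 : lpNorm (fun ω => blockDev (X 0 ω) - S 0 ω) 2 P = ‖blockDev x₀‖ := by
    simp only [h0, hS0, sub_zero]
    rw [lpNorm_const two_ne_zero (IsProbabilityMeasure.ne_zero P)]
    simp
  have hsum := lpNorm_two_le_add (memLp_blockDev (hX k)) (hH k) (hSL k) zero_le_one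
    zero_le_one (fun ω => by
      simpa using norm_add_le (blockDev (X k ω) - S k ω) (S k ω))
  have h4 := geometric_mul_le hγ0 hγ1 (mul_nonneg hα hD) k
  have h7 := hSc k
  rw [hH0] at hHk
  linarith

end Consensus

section NodeAverage

variable {Ω : Type*} {mΩ : MeasurableSpace Ω} {P : Measure Ω}
  {N : ℕ} {E : Type*} [NormedAddCommGroup E] [InnerProductSpace ℝ E]
  {g : Fin N → E → E} {W V : Matrix (Fin N) (Fin N) ℝ} {lam : Fin N → ℝ} {α μ L γ : ℝ}
  {X ξ : ℕ → Ω → PiLp 2 (fun _ : Fin N => E)} {x₀ : PiLp 2 (fun _ : Fin N => E)}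

lemma norm_decentralized_step_sub_sq_le {l : ℝ} (hα : 0 ≤ α) (hμ : 0 < μ) (hμL : μ ≤ L)
    (hV : V * Vᵀ = 1) (hW : W = Vᵀ * Matrix.diagonal lam * V)
    (hl : ∀ i, l ≤ lam i) (h1 : ∀ i, lam i ≤ 1) (hl1 : l ≤ 1) (hstep : α * L ≤ 1 + l)
    (hg : ∀ i x y, ‖g i x - g i y‖ ^ 2 + μ * L * ‖x - y‖ ^ 2 ≤ (L + μ) * ⟪g i x - g i y, x - y⟫)
    {x' : PiLp 2 (fun _ : Fin N => E)} (hx' : mixing W x' - α • blockGrad g x' = x')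
    (z : PiLp 2 (fun _ : Fin N => E)) :
    ‖mixing W z - α • blockGrad g z - x'‖ ^ 2 ≤
      (1 - α * μ * (1 + l - α * L)) * ‖z - x'‖ ^ 2 := by
  have hG := bounds_of_interpolation hμ hμL (blockGrad_interpolation hg z x')
  have hp := laplacian_bounds hV hW hl h1 (z - x')
  have hz : 0 ≤ μ * ‖z - x'‖ ^ 2 := by positivity
  have h := norm_sub_sub_smul_sq_le hα (hμ.le.trans hμL) (by linarith : 0 ≤ 1 - l)
    (by linarith) hp.1 hp.2 (hz.trans hG.1) hG.2.1 hG.1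
  have h2 : mixing W z - α • blockGrad g z - x' = z - x' - (z - x' - mixing W (z - x')) -
      α • (blockGrad g z - blockGrad g x') := by
    nth_rewrite 1 [← hx']
    rw [map_sub, smul_sub]
    abel
  rw [h2]
  refine h.trans_eq ?_
  ring

lemma lipschitzWith_sub_smul {H : Type*} [NormedAddCommGroup H] [NormedSpace ℝ H] {G : H → H}
    (hG : ∀ x y, ‖G x - G y‖ ≤ L * ‖x - y‖) (A : H →L[ℝ] H) :
    LipschitzWith (Real.toNNReal (‖A‖ + |α| * L)) fun z => A z - α • G z := by
  refine lipschitzWith_of_norm_sub_le fun x y => ?_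
  have h : A x - α • G x - (A y - α • G y) = A (x - y) - α • (G x - G y) := by
    rw [map_sub, smul_sub]
    abel
  rw [h, add_mul, mul_assoc]
  refine (norm_sub_le _ _).trans (add_le_add (A.le_opNorm _) ?_)
  rw [norm_smul, Real.norm_eq_abs]
  gcongr
  exact hG x y

lemma sq_le_two_mul_add_sq {x a b : ℝ} (hx : 0 ≤ x) (h : x ≤ a + b) :
    x ^ 2 ≤ 2 * a ^ 2 + 2 * b ^ 2 := by
  have := pow_le_pow_left₀ hx h 2
  linarith [sq_nonneg (a - b)]

lemma integral_norm_add_sq_le {H : Type*} [NormedAddCommGroup H] {A B : Ω → H}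
    (hA : MemLp A 2 P) (hB : MemLp B 2 P) :
    ∫ ω, ‖A ω + B ω‖ ^ 2 ∂P ≤ 2 * ∫ ω, ‖A ω‖ ^ 2 ∂P + 2 * ∫ ω, ‖B ω‖ ^ 2 ∂P := by
  have hA2 := (hA.integrable_norm_pow two_ne_zero).const_mul 2
  have hB2 := (hB.integrable_norm_pow two_ne_zero).const_mul 2
  rw [← integral_const_mul, ← integral_const_mul, ← integral_add hA2 hB2]
  refine integral_mono ((hA.add hB).integrable_norm_pow two_ne_zero) (hA2.add hB2) fun ω => ?_
  exact sq_le_two_mul_add_sq (norm_nonneg _) (norm_add_le (A ω) (B ω))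

lemma integral_norm_sq_le_two_mul_add {H : Type*} [NormedAddCommGroup H] [IsProbabilityMeasure P]
    {A B : Ω → H} {c β : ℝ} {b : H} (hA : MemLp A 2 P) (hB : MemLp B 2 P)
    (h : ∀ ω, ‖A ω - b‖ ≤ β * ‖B ω‖) (hc : ∫ ω, ‖B ω‖ ^ 2 ∂P ≤ c) :
    ∫ ω, ‖A ω‖ ^ 2 ∂P ≤ 2 * β ^ 2 * c + 2 * ‖b‖ ^ 2 := by
  have hAb : MemLp (fun ω => A ω - b) 2 P := hA.sub (memLp_const b)
  have h1 := integral_norm_add_sq_le hAb (memLp_const b)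
  have h2 : ∫ ω, ‖A ω - b‖ ^ 2 ∂P ≤ ∫ ω, β ^ 2 * ‖B ω‖ ^ 2 ∂P := by
    refine integral_mono (hAb.integrable_norm_pow two_ne_zero)
      ((hB.integrable_norm_pow two_ne_zero).const_mul _) fun ω => ?_
    have h3 := pow_le_pow_left₀ (norm_nonneg _) (h ω) 2
    rwa [mul_pow] at h3
  have h3 : β ^ 2 * ∫ ω, ‖B ω‖ ^ 2 ∂P ≤ β ^ 2 * c := by gcongr
  simp only [sub_add_cancel, integral_const, probReal_univ, one_smul] at h1
  rw [integral_const_mul] at h2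
  linarith

lemma le_of_le_mul_add_geometric {v : ℕ → ℝ} {κ a b : ℝ} (hα : 0 ≤ α) (hμ : 0 < μ)
    (hαμ : α * μ ≤ 1) (hγ0 : 0 ≤ γ) (hγ1 : γ < 1) (hκ : 0 ≤ κ) (ha : 0 ≤ a)
    (h0 : v 0 ≤ κ * (b / μ))
    (h : ∀ k, v (k + 1) ≤ (1 - α * μ) * v k + α * (κ * (γ ^ k * a + b))) (k : ℕ) :
    v k ≤ κ * (α * a / (1 - γ) + b / μ) := by
  have hγ : 0 < 1 - γ := by linarith
  have hs : ∀ k, v k ≤ κ * (α * a / (1 - γ) * (1 - γ ^ k) + b / μ) := by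
    intro k
    induction k with
    | zero => simpa using h0
    | succ k ih =>
      have hp : 0 ≤ 1 - γ ^ k := sub_nonneg.2 (pow_le_one₀ hγ0 hγ1.le)
      have h1 : 0 ≤ α * μ * (κ * (α * a / (1 - γ) * (1 - γ ^ k))) := by positivity
      have h2 : (1 - α * μ) * v k ≤
          (1 - α * μ) * (κ * (α * a / (1 - γ) * (1 - γ ^ k) + b / μ)) :=
        mul_le_mul_of_nonneg_left ih (by linarith)
      have h3 : κ * (α * a / (1 - γ) * (1 - γ ^ (k + 1)) + b / μ) =
          (1 - α * μ) * (κ * (α * a / (1 - γ) * (1 - γ ^ k) + b / μ)) +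
            α * (κ * (γ ^ k * a + b)) + α * μ * (κ * (α * a / (1 - γ) * (1 - γ ^ k))) := by
        field_simp
        ring
      linarith [h k]
  have h1 : 0 ≤ κ * (α * a / (1 - γ) * γ ^ k) := by positivity
  linarith [hs k]

/-- The node average stays close to the centralized iteration driven by the averaged noise. -/
lemma lpNorm_blockMean_sub_le [IsProbabilityMeasure P] {Y : ℕ → Ω → E} {a b : ℝ} (hN : 0 < N)
    (hα : 0 ≤ α) (hμ : 0 < μ) (hL : 0 ≤ L) (hαμ : α * μ ≤ 1) (hγ0 : 0 ≤ γ) (hγ1 : γ < 1)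
    (ha : 0 ≤ a) (hb : 0 ≤ b) (hcol : ∀ j, ∑ i, W i j = 1)
    (hlip : ∀ x y, ‖blockGrad g x - blockGrad g y‖ ≤ L * ‖x - y‖)
    (hcontr : ∀ u v, ‖(u - v) - α • (meanGrad g u - meanGrad g v)‖ ≤ (1 - α * μ) * ‖u - v‖)
    (hX : ∀ k, MemLp (X k) 2 P) (hY : ∀ k, MemLp (Y k) 2 P)
    (h0 : ∀ ω, Y 0 ω = blockMean (X 0 ω))
    (hrecX : ∀ k ω, X (k + 1) ω = mixing W (X k ω) - α • blockGrad g (X k ω) - α • ξ k ω)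
    (hrecY : ∀ k ω, Y (k + 1) ω = Y k ω - α • meanGrad g (Y k ω) - α • blockMean (ξ k ω))
    (hdev : ∀ k, lpNorm (fun ω => blockDev (X k ω)) 2 P ≤ γ ^ k * a + b) (k : ℕ) :
    lpNorm (fun ω => blockMean (X k ω) - Y k ω) 2 P ≤
      L / √N * (α * a / (1 - γ) + b / μ) := by
  have hM : ∀ k, MemLp (fun ω => blockMean (X k ω) - Y k ω) 2 P := fun k =>
    ((blockMean (N := N) (E := E)).comp_memLp' (hX k)).sub (hY k)
  refine le_of_le_mul_add_geometric (v := fun k => lpNorm (fun ω => blockMean (X k ω) - Y k ω) 2 P)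
    hα hμ hαμ hγ0 hγ1 (by positivity) ha ?_ (fun k => ?_) k
  · simp only [h0, sub_self]
    rw [show (fun _ : Ω => (0 : E)) = 0 from rfl, lpNorm_zero]
    positivity
  · refine (lpNorm_two_le_add (b := 1 - α * μ) (c := α * (L / √N)) (hM (k + 1)) (hM k)
      (memLp_blockDev (hX k)) (by linarith) (by positivity) fun ω => ?_).trans ?_
    · have h1 : blockMean (X (k + 1) ω) - Y (k + 1) ω =
          ((blockMean (X k ω) - Y k ω) -
            α • (meanGrad g (blockMean (X k ω)) - meanGrad g (Y k ω))) -
          α • (blockMean (blockGrad g (X k ω)) - meanGrad g (blockMean (X k ω))) := by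
        rw [hrecX, hrecY, map_sub, map_sub, map_smul, map_smul, blockMean_mixing hcol, smul_sub,
          smul_sub]
        abel
      rw [h1]
      refine (norm_sub_le _ _).trans (add_le_add (hcontr _ _) ?_)
      rw [norm_smul, Real.norm_eq_abs, abs_of_nonneg hα, mul_assoc]
      gcongr
      exact norm_blockMean_blockGrad_sub_meanGrad_le hN hL hlip _
    · rw [mul_assoc α]
      gcongr
      exact hdev k

end NodeAverage

set_option maxHeartbeats 1000000 in
/-- **Proposition (D-SG, node averages).**  Under the stated stepsize conditions, the node
average `x̄^{(k)} = (1/N)∑ᵢ x_i^{(k)}` of the D-SG iterates satisfies the explicit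
bias/variance/network-effect bound of Proposition 3 of the paper. -/
theorem dsg_node_average_bound
    {N d : ℕ} (hN : 0 < N) (hd : 0 < d)
    (μ L α σ : ℝ) (hμ : 0 < μ) (hμL : μ ≤ L) (hσ : 0 ≤ σ)
    -- the symmetric doubly stochastic mixing matrix and its eigenvalues, in decreasing order
    (W : Matrix (Fin N) (Fin N) ℝ)
    (hWsymm : W.IsSymm)
    (hWnonneg : ∀ i j, 0 ≤ W i j)
    (hWrow : ∀ i, ∑ j, W i j = 1)
    (hWcol : ∀ j, ∑ i, W i j = 1)
    (lam : Fin N → ℝ) (V : Matrix (Fin N) (Fin N) ℝ)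
    (hV : V * Vᵀ = 1)
    (hWeig : W = Vᵀ * Matrix.diagonal lam * V)
    (hlamAnti : Antitone lam)
    (hlamTop : lam ⟨0, hN⟩ = 1)
    (lamN : ℝ) (hlamN : lamN = lam ⟨N - 1, Nat.sub_lt hN Nat.one_pos⟩)
    -- γ = max{|λ₂|, |λ_N|} < 1 and a constant C₁ ≥ 0
    (γ C₁ : ℝ) (hγdef : ∀ h2 : 1 < N, γ = max |lam ⟨1, h2⟩| |lamN|)
    (hγ0 : 0 ≤ γ) (hγ1 : γ < 1) (hC₁ : 0 ≤ C₁)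
    -- stepsize conditions
    (hα0 : 0 < α) (hα1 : α ≤ 2 / (L + μ)) (hα2 : α < (1 + lamN) / L)
    (hα3 : μ * α * (1 + lamN - α * L) < 1)
    (hγne : γ ^ 2 ≠ 1 - α * μ * (1 - α * L / 2))
    -- the local objectives: μ-strongly convex with L-Lipschitz gradients
    (f : Fin N → EuclideanSpace ℝ (Fin d) → ℝ)
    (gradf : Fin N → EuclideanSpace ℝ (Fin d) → EuclideanSpace ℝ (Fin d))
    (hgrad : ∀ i x, HasGradientAt (f i) (gradf i x) x)
    (hlip : ∀ i, LipschitzWith (Real.toNNReal L) (gradf i))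
    (hconv : ∀ i, ConvexOn ℝ Set.univ (fun x => f i x - μ / 2 * ‖x‖ ^ 2))
    -- the minimizer x_* of f = (1/N)∑ f_i, and x^* = (x_*,…,x_*)
    (xstar : EuclideanSpace ℝ (Fin d))
    (hxstar : ∀ y, (1 / (N : ℝ)) * ∑ i, f i xstar ≤ (1 / (N : ℝ)) * ∑ i, f i y)
    (xstarN : PiLp 2 (fun _ : Fin N => EuclideanSpace ℝ (Fin d)))
    (hxstarN : ∀ i, xstarN i = xstar)
    -- the fixed point x^∞ : solution of (I − 𝒲)x + α ∇F(x) = 0, and its distance to x^*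
    (xinf : PiLp 2 (fun _ : Fin N => EuclideanSpace ℝ (Fin d)))
    (hxinf : ∀ i, (xinf i - ∑ j, W i j • xinf j) + α • gradf i (xinf i) = 0)
    (hxinfstar : ‖xinf - xstarN‖ ≤ Real.sqrt N * C₁ * α / (1 - γ))
    -- probability space, filtration and the D-SG iterates
    {Ω : Type} {mΩ : MeasurableSpace Ω} (P : Measure Ω) [IsProbabilityMeasure P]
    (ℱ : ℕ → MeasurableSpace Ω) (hℱ : ∀ k, ℱ k ≤ mΩ) (hℱmono : Monotone ℱ)
    (X w : ℕ → Ω → PiLp 2 (fun _ : Fin N => EuclideanSpace ℝ (Fin d)))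
    (x0 : PiLp 2 (fun _ : Fin N => EuclideanSpace ℝ (Fin d)))
    (hX0 : ∀ ω, X 0 ω = x0)
    (hXadapted : ∀ k, StronglyMeasurable[ℱ k] (X k))
    (hwmeas : ∀ k, StronglyMeasurable[ℱ (k + 1)] (w (k + 1)))
    (hrec : ∀ k ω i, X (k + 1) ω i =
      (∑ j, W i j • X k ω j) - α • gradf i (X k ω i) - α • w (k + 1) ω i)
    -- the gradient noise: per node, conditionally centered with conditional variance ≤ σ²,
    -- and conditionally uncorrelated across distinct nodes
    (hwmean : ∀ k i, P[fun ω => w (k + 1) ω i|ℱ k] =ᵐ[P] 0)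
    (hwL2 : ∀ k, Integrable (fun ω => ‖w (k + 1) ω‖ ^ 2) P)
    (hwvar : ∀ k i, ∀ᵐ ω ∂P, (P[fun ω' => ‖w (k + 1) ω' i‖ ^ 2|ℱ k]) ω ≤ σ ^ 2)
    (hwcross : ∀ k i j, i ≠ j →
      P[fun ω => ⟪w (k + 1) ω i, w (k + 1) ω j⟫|ℱ k] =ᵐ[P] 0) :
    ∀ k : ℕ,
      ∫ ω, ‖(1 / (N : ℝ)) • (∑ i, X k ω i) - xstar‖ ^ 2 ∂P ≤
        8 * (α / (μ * (1 - α * L / 2)) + (1 + α * L) ^ 2 / (μ ^ 2 * (1 - α * L / 2) ^ 2)) *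
            (L ^ 2 *
                (4 * L ^ 2 * ‖x0 - xstarN‖ ^ 2 + 8 * L ^ 2 * C₁ ^ 2 * α ^ 2 * N / (1 - γ) ^ 2 +
                  2 * L ^ 2 * α * σ ^ 2 * N / (μ * (1 + lamN - α * L)) +
                  4 * ∑ i, ‖gradf i xstar‖ ^ 2) * α ^ 2 / (N * (1 - γ) ^ 2) +
              L ^ 2 * σ ^ 2 * α ^ 2 / (1 - γ ^ 2)) +
          8 * ((γ ^ (2 * k) - (1 - α * μ * (1 - α * L / 2)) ^ k) /
                (γ ^ 2 - (1 - α * μ * (1 - α * L / 2)))) * (L ^ 2 * γ ^ 2 / N) * ‖x0‖ ^ 2 +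
          2 * (1 - α * μ) ^ (2 * k) * ‖(1 / (N : ℝ)) • (∑ i, x0 i) - xstar‖ ^ 2 +
          (1 - (1 - α * μ) ^ (2 * k)) / (μ * (1 - α * μ / 2)) * (α * σ ^ 2 / N) := by
  have hL : 0 < L := hμ.trans_le hμL
  have hN' : (0 : ℝ) < N := by positivity
  have hlow : ∀ i, lamN ≤ lam i := fun i => by
    rw [hlamN]
    exact hlamAnti (Fin.le_def.2 (Nat.le_sub_one_of_lt i.2))
  have htop : ∀ i, lam i ≤ 1 := fun i => by
    rw [← hlamTop]
    exact hlamAnti (Fin.le_def.2 (Nat.zero_le _))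
  have hlam1 : lamN ≤ 1 := (hlow ⟨0, hN⟩).trans (htop _)
  have hlamγ : ∀ i, i ≠ ⟨0, hN⟩ → |lam i| ≤ γ := by
    intro i hi
    have hi0 : 1 ≤ i.1 := Nat.one_le_iff_ne_zero.2 fun h => hi (Fin.ext h)
    have h2 : 1 < N := hi0.trans_lt i.2
    have h3 : lam i ≤ lam ⟨1, h2⟩ := hlamAnti (Fin.le_def.2 hi0)
    rw [hγdef h2, abs_le]
    exact ⟨neg_le.1 ((neg_le_abs _).trans' (neg_le_neg (hlow i)) |>.trans (le_max_right _ _)),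
      h3.trans ((le_abs_self _).trans (le_max_left _ _))⟩
  have hαL : α * L < 1 + lamN := (lt_div_iff₀ hL).1 hα2
  have hαμ : α * μ ≤ 1 := by
    have h1 : α * (L + μ) ≤ 2 := (le_div_iff₀ (by linarith)).1 hα1
    nlinarith
  have hδ : 0 < 1 + lamN - α * L := by linarith
  have hlip' : ∀ i x y, ‖gradf i x - gradf i y‖ ≤ L * ‖x - y‖ := fun i x y => by
    have := (hlip i).norm_sub_le x y
    rwa [Real.coe_toNNReal _ hL.le] at this
  have hinterp : ∀ i x y, ‖gradf i x - gradf i y‖ ^ 2 + μ * L * ‖x - y‖ ^ 2 ≤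
      (L + μ) * ⟪gradf i x - gradf i y, x - y⟫ := fun i x y =>
    strongConvex_interpolation hμL (hgrad i) (hlip' i) (hconv i) x y
  have hGlip : ∀ x y, ‖blockGrad gradf x - blockGrad gradf y‖ ≤ L * ‖x - y‖ := fun x y =>
    (bounds_of_interpolation hμ hμL (blockGrad_interpolation hinterp x y)).2.2
  have hmix := norm_mixing_le_of_sum_eq_zero (E := EuclideanSpace ℝ (Fin d)) hV hWeig hWrow
    hγ0 hγ1 hlamγ
  have hcontr : ∀ u v : EuclideanSpace ℝ (Fin d),
      ‖(u - v) - α • (meanGrad gradf u - meanGrad gradf v)‖ ≤ (1 - α * μ) * ‖u - v‖ := fun u v =>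
    have h := meanGrad_interpolation hN hinterp u v
    norm_sub_smul_le_of_interpolation hα0.le hμ hμL hα1 h (bounds_of_interpolation hμ hμL h).1
  have hxstarN' : xstarN = blockConst xstar := by
    ext i : 1
    exact hxstarN i
  have hstar : meanGrad gradf xstar = 0 := meanGrad_eq_zero_of_minimizer hgrad hxstar
  have hfix : mixing W xinf - α • blockGrad gradf xinf = xinf := by
    ext i : 1
    have h := hxinf i
    simp only [PiLp.sub_apply, PiLp.smul_apply, mixing_apply, blockGrad_apply]
    rw [← sub_eq_zero, ← neg_eq_zero, ← h]
    abel
  have hrec' : ∀ k ω, X (k + 1) ω =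
      (mixing W (X k ω) - α • blockGrad gradf (X k ω)) - α • w (k + 1) ω := fun k ω => by
    ext i : 1
    simpa using hrec k ω i
  have hw2 : ∀ k, MemLp (w (k + 1)) 2 P := fun k =>
    (memLp_two_iff_integrable_sq_norm
      ((hwmeas k).mono (hℱ (k + 1))).aestronglyMeasurable).2 (hwL2 k)
  have hΦ := lipschitzWith_sub_smul (α := α) hGlip (mixing W)
  have hX2 := memLp_of_recursion hΦ hX0 hrec' hw2
  have horth : ∀ k (Y : Ω → PiLp 2 (fun _ : Fin N => EuclideanSpace ℝ (Fin d))),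
      StronglyMeasurable[ℱ k] Y → MemLp Y 2 P → ∫ ω, ⟪Y ω, w (k + 1) ω⟫ ∂P = 0 :=
    fun k Y hY hY2 => integral_inner_blocks_eq_zero (hℱ k) (hw2 k) (hwmean k) hY hY2
  have hwv : ∀ k, ∫ ω, ‖w (k + 1) ω‖ ^ 2 ∂P ≤ N * σ ^ 2 := fun k =>
    integral_norm_blocks_sq_le (hℱ k) (hw2 k) (hwvar k)
  -- uniform second moment bound on the gradients
  obtain ⟨Dsq, hDsq⟩ : ∃ Dsq, Dsq = 4 * L ^ 2 * ‖x0 - xstarN‖ ^ 2 +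
      8 * L ^ 2 * C₁ ^ 2 * α ^ 2 * N / (1 - γ) ^ 2 +
      2 * L ^ 2 * α * σ ^ 2 * N / (μ * (1 + lamN - α * L)) +
      4 * ∑ i, ‖gradf i xstar‖ ^ 2 := ⟨_, rfl⟩
  rw [← hDsq]
  have hG2 : ∀ k, MemLp (fun ω => blockGrad gradf (X k ω)) 2 P := fun k =>
    (lipschitzWith_of_norm_sub_le hGlip).comp_memLp_of_isFiniteMeasure (hX2 k)
  have hXinf : ∀ k, ∫ ω, ‖X k ω - xinf‖ ^ 2 ∂P ≤
      ‖x0 - xinf‖ ^ 2 + α * σ ^ 2 * N / (μ * (1 + lamN - α * L)) := by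
    intro k
    have hr1 : 1 - α * μ * (1 + lamN - α * L) < 1 := by
      have : 0 < α * μ * (1 + lamN - α * L) := by positivity
      linarith
    have hr0 : 0 ≤ 1 - α * μ * (1 + lamN - α * L) := by linarith
    have h := integral_norm_sub_sq_le_of_recursion hℱmono hΦ hX0 hrec' hw2 hwmeas horth hwv
      hr0 hr1 (norm_decentralized_step_sub_sq_le hα0.le hμ hμL hV hWeig hlow htop hlam1 hαL.le
        hinterp hfix) k
    refine h.trans (add_le_add (mul_le_of_le_one_left (by positivity) (pow_le_one₀ hr0 hr1.le))
      ((geometric_mul_le hr0 hr1 (by positivity) k).trans_eq ?_))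
    rw [sub_sub_cancel]
    field_simp
  have hs : ‖xinf - xstarN‖ ^ 2 ≤ N * C₁ ^ 2 * α ^ 2 / (1 - γ) ^ 2 := by
    refine (pow_le_pow_left₀ (norm_nonneg _) hxinfstar 2).trans_eq ?_
    rw [div_pow, mul_pow, mul_pow, Real.sq_sqrt hN'.le]
  have hgstar : ‖blockGrad gradf xstarN‖ ^ 2 = ∑ i, ‖gradf i xstar‖ ^ 2 := by
    rw [PiLp.norm_sq_eq_of_L2]
    simp [hxstarN]
  have hGD : ∀ k, lpNorm (fun ω => blockGrad gradf (X k ω)) 2 P ≤ √Dsq := by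
    intro k
    refine Real.le_sqrt_of_sq_le ?_
    rw [lpNorm_two_sq (hG2 k)]
    refine (integral_norm_sq_le_two_mul_add (hG2 k) ((hX2 k).sub (memLp_const xinf))
      (fun ω => hGlip (X k ω) xinf) (hXinf k)).trans ?_
    have h1 : ‖x0 - xinf‖ ^ 2 ≤ 2 * ‖x0 - xstarN‖ ^ 2 + 2 * ‖xinf - xstarN‖ ^ 2 := by
      have := norm_sub_le (x0 - xstarN) (xinf - xstarN)
      rw [sub_sub_sub_cancel_right] at this
      exact sq_le_two_mul_add_sq (norm_nonneg _) this
    have h2 : ‖blockGrad gradf xinf‖ ^ 2 ≤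
        2 * L ^ 2 * ‖xinf - xstarN‖ ^ 2 + 2 * ‖blockGrad gradf xstarN‖ ^ 2 := by
      have h3 := hGlip xinf xstarN
      have h4 : ‖blockGrad gradf xinf‖ ≤ L * ‖xinf - xstarN‖ + ‖blockGrad gradf xstarN‖ := by
        have := norm_add_le (blockGrad gradf xinf - blockGrad gradf xstarN)
          (blockGrad gradf xstarN)
        rw [sub_add_cancel] at this
        linarith
      refine (sq_le_two_mul_add_sq (norm_nonneg _) h4).trans_eq ?_
      ring
    have h3 : 2 * L ^ 2 * ‖x0 - xinf‖ ^ 2 ≤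
        2 * L ^ 2 * (2 * ‖x0 - xstarN‖ ^ 2 + 2 * ‖xinf - xstarN‖ ^ 2) := by gcongr
    have h4 : 8 * L ^ 2 * ‖xinf - xstarN‖ ^ 2 ≤
        8 * L ^ 2 * (N * C₁ ^ 2 * α ^ 2 / (1 - γ) ^ 2) := by gcongr
    rw [hgstar] at h2
    calc 2 * L ^ 2 * (‖x0 - xinf‖ ^ 2 + α * σ ^ 2 * N / (μ * (1 + lamN - α * L))) +
          2 * ‖blockGrad gradf xinf‖ ^ 2
        ≤ 4 * L ^ 2 * ‖x0 - xstarN‖ ^ 2 + 8 * L ^ 2 * (N * C₁ ^ 2 * α ^ 2 / (1 - γ) ^ 2) +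
          2 * L ^ 2 * (α * σ ^ 2 * N / (μ * (1 + lamN - α * L))) +
          4 * ∑ i, ‖gradf i xstar‖ ^ 2 := by linarith
      _ = Dsq := by
        rw [hDsq]
        ring
  -- the consensus error
  have hdev := lpNorm_blockDev_le hα0.le hγ0 hγ1 (Real.sqrt_nonneg Dsq) hWrow hWcol hmix hℱmono
    hX0 hrec' hX2 hG2 hGD hw2 hwmeas horth hwv
  have haD : 2 * L * ‖blockDev x0‖ ≤ √Dsq := by
    have h1 : ‖blockDev x0‖ ≤ ‖x0 - xstarN‖ := by
      have h2 : blockDev x0 = blockDev (x0 - xstarN) := by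
        rw [map_sub, blockDev_eq_sub_blockConst xstarN, hxstarN', blockMean_blockConst hN,
          sub_self, sub_zero]
      rw [h2]
      exact norm_blockDev_le _
    have h2 : 2 * L * ‖blockDev x0‖ ≤ 2 * L * ‖x0 - xstarN‖ := by gcongr
    refine h2.trans (Real.le_sqrt_of_sq_le ?_)
    have h3 : 0 ≤ 8 * L ^ 2 * C₁ ^ 2 * α ^ 2 * N / (1 - γ) ^ 2 := by positivity
    have h4 : 0 ≤ 2 * L ^ 2 * α * σ ^ 2 * N / (μ * (1 + lamN - α * L)) := by positivity
    have h5 : 0 ≤ 4 * ∑ i, ‖gradf i xstar‖ ^ 2 := by positivity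
    rw [hDsq]
    linarith
  -- the centralized iteration driven by the averaged noise
  obtain ⟨Y, hY0, hYrec⟩ : ∃ Y : ℕ → Ω → EuclideanSpace ℝ (Fin d),
      (∀ ω, Y 0 ω = blockMean x0) ∧ ∀ k ω, Y (k + 1) ω =
        (Y k ω - α • meanGrad gradf (Y k ω)) - α • blockMean (w (k + 1) ω) :=
    ⟨stochIter (fun u => u - α • meanGrad gradf u) α (fun k ω => blockMean (w (k + 1) ω))
      (blockMean x0), fun _ => rfl, fun _ _ => rfl⟩
  have hΨ : LipschitzWith (Real.toNNReal (1 - α * μ)) fun u => u - α • meanGrad gradf u :=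
    lipschitzWith_of_norm_sub_le fun u v => by
      have h : u - α • meanGrad gradf u - (v - α • meanGrad gradf v) =
          (u - v) - α • (meanGrad gradf u - meanGrad gradf v) := by
        rw [smul_sub]
        abel
      rw [h]
      exact hcontr u v
  have hη2 : ∀ k, MemLp (fun ω => blockMean (w (k + 1) ω)) 2 P := fun k =>
    (blockMean (N := N) (E := EuclideanSpace ℝ (Fin d))).comp_memLp' (hw2 k)
  have hY2 := memLp_of_recursion hΨ hY0 hYrec hη2
  have hq1 : (1 - α * μ) ^ 2 < 1 :=
    pow_lt_one₀ (by linarith) (by linarith [mul_pos hα0 hμ]) two_ne_zero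
  have hYstar := integral_norm_sub_sq_le_of_recursion (z' := xstar) (ρ := (1 - α * μ) ^ 2)
    hℱmono hΨ hY0 hYrec hη2
    (fun k => blockMean.continuous.comp_stronglyMeasurable (hwmeas k))
    (fun k Z hZ hZ2 => integral_inner_blockMean_eq_zero (hℱ k) (hw2 k) (hwmean k) hZ hZ2)
    (fun k => integral_norm_blockMean_sq_le (hℱ k) (hw2 k) (hwvar k) (hwcross k))
    (sq_nonneg _) hq1 (fun u => by
      have h := hcontr u xstar
      rw [hstar, sub_zero] at h
      rw [sub_right_comm, ← mul_pow]
      gcongr)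
  have herr := lpNorm_blockMean_sub_le hN hα0.le hμ hL.le hαμ hγ0 hγ1
    (norm_nonneg (blockDev x0)) (by positivity) hWcol hGlip hcontr hX2 hY2
    (fun ω => by rw [hY0, hX0]) hrec' hYrec hdev
  intro k
  have hM : MemLp (fun ω => blockMean (X k ω) - Y k ω) 2 P :=
    ((blockMean (N := N) (E := EuclideanSpace ℝ (Fin d))).comp_memLp' (hX2 k)).sub (hY2 k)
  have hγ2 : 0 < 1 - γ ^ 2 := sub_pos.2 (pow_lt_one₀ hγ0 hγ1 two_ne_zero)
  have hnet := sq_le_network_effect (σ := σ) hN' hμ hμL hα0 (by linarith) hγ0 hγ1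
    (norm_nonneg (blockDev x0)) haD (Real.sq_sqrt (by positivity)) lpNorm_nonneg (herr k)
  have hD0 : 0 ≤ Dsq := by
    rw [hDsq]
    positivity
  rw [lpNorm_two_sq hM, Real.sq_sqrt hD0] at hnet
  simp only [← blockMean_apply]
  have hYk2 : MemLp (fun ω => Y k ω - xstar) 2 P := (hY2 k).sub (memLp_const _)
  have hsplit := integral_norm_add_sq_le hM hYk2
  simp only [sub_add_sub_cancel] at hsplit
  have hthird : 0 ≤ 8 * ((γ ^ (2 * k) - (1 - α * μ * (1 - α * L / 2)) ^ k) /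
      (γ ^ 2 - (1 - α * μ * (1 - α * L / 2)))) * (L ^ 2 * γ ^ 2 / N) * ‖x0‖ ^ 2 := by
    have hρ0 : 0 ≤ 1 - α * μ * (1 - α * L / 2) :=
      sub_nonneg.2 (mul_le_one₀ hαμ (by linarith) (by linarith [mul_pos hα0 hL]))
    have h := div_pow_sub_pow_nonneg (sq_nonneg γ) hρ0 k
    rw [pow_mul]
    positivity
  have hlast : 2 * ((1 - ((1 - α * μ) ^ 2) ^ k) / (1 - (1 - α * μ) ^ 2) *
      (α ^ 2 * (σ ^ 2 / N))) =
      (1 - (1 - α * μ) ^ (2 * k)) / (μ * (1 - α * μ / 2)) * (α * σ ^ 2 / N) := by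
    have h1 : 1 - α * μ / 2 ≠ 0 := by
      have : 0 < 1 - α * μ / 2 := by linarith
      exact this.ne'
    have h2 : 1 - (1 - α * μ) ^ 2 = 2 * α * μ * (1 - α * μ / 2) := by ring
    rw [h2, ← pow_mul]
    field_simp
  have hYk := hYstar k
  rw [← pow_mul] at hYk
  rw [← pow_mul] at hlast
  linarith
end
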